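/- Let A be a C*-algebra. The following are equivalent: (i) A is nowhere scattered; (ii) for every positive a ∈ A and every n ∈ ℕ, the class [a ⊗ 1ₙ] ∈ Cu(A) is weakly (2n,ω)-divisible; (iii) for every positive a ∈ A there exists n ∈ ℕ such that the class [a ⊗ 1ₙ] ∈ Cu(A) is weakly (n+1,ω)-divisible. -/

import Mathlib

/-!
Common definitions: abstract Cuntz semigroups, divisibility, and C*-algebra notions
(nowhere scatteredness, σ-unitality, etc.) used to formalize the statements.
-/

open scoped MultiplierAlgebra ENNReal
open Filter Topology

noncomputable section

universe uu vv

/-- The (sequential) way-below relation `x ≪ y` (compact containment) in a partially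
ordered set: whenever an increasing sequence has a supremum lying above `y`, some term
of the sequence already lies above `x`. -/
def WayBelow {S : Type*} [PartialOrder S] (x y : S) : Prop :=
  ∀ f : ℕ → S, Monotone f → ∀ s : S, IsLUB (Set.range f) s → y ≤ s → ∃ n, x ≤ f n

/-- An abstract Cuntz semigroup (`Cu`-semigroup): a positively ordered abelian monoid in
which every increasing sequence has a supremum, every element is the supremum of a
`≪`-increasing sequence, addition preserves `≪`, and which satisfies the standard
axioms (O5) (almost algebraic order) and (O6) (almost Riesz decomposition), as well as
the existence of infima with idempotents `∞y = sup_n n•y` (all of these hold in the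
Cuntz semigroup of any C*-algebra). -/
class CuSemigroup (S : Type*) extends AddCommMonoid S, PartialOrder S where
  add_le_add' : ∀ a b : S, a ≤ b → ∀ c : S, c + a ≤ c + b
  zero_le' : ∀ x : S, 0 ≤ x
  exists_isLUB : ∀ f : ℕ → S, Monotone f → ∃ s : S, IsLUB (Set.range f) s
  exists_waybelow_seq : ∀ x : S, ∃ f : ℕ → S, Monotone f ∧
    (∀ n, WayBelow (f n) (f (n + 1))) ∧ IsLUB (Set.range f) x
  waybelow_add : ∀ {x y z w : S}, WayBelow x y → WayBelow z w → WayBelow (x + z) (y + w)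
  /-- axiom (O5) -/
  almost_algebraic : ∀ x' x y' y z : S, WayBelow x' x → WayBelow y' y → x + y ≤ z →
    ∃ c : S, y' ≤ c ∧ x' + c ≤ z ∧ z ≤ x + c
  /-- axiom (O6) -/
  almost_riesz : ∀ x' x y z : S, WayBelow x' x → x ≤ y + z →
    ∃ v w : S, v ≤ x ∧ v ≤ y ∧ w ≤ x ∧ w ≤ z ∧ x' ≤ v + w
  /-- `infty y = ∞·y = sup_n n•y` -/
  infty : S → S
  isLUB_infty : ∀ y : S, IsLUB (Set.range fun n : ℕ => n • y) (infty y)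
  /-- the infimum `x ⊓ ∞y`, which exists in the Cuntz semigroup of any C*-algebra -/
  meetInfty : S → S → S
  isGLB_meetInfty : ∀ x y : S, IsGLB {x, infty y} (meetInfty x y)

namespace CuDiv

variable {S : Type*} [CuSemigroup S]

/-- `x` is weakly `(m, n)`-divisible. -/
def IsWeaklyDivisible (m n : ℕ) (x : S) : Prop :=
  ∀ x' : S, WayBelow x' x → ∃ y : Fin n → S, x' ≤ ∑ j, y j ∧ ∀ j, m • y j ≤ x

/-- `x` is `(m, n)`-divisible. -/
def IsDivisible (m n : ℕ) (x : S) : Prop :=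
  ∀ x' : S, WayBelow x' x → ∃ y : S, x' ≤ n • y ∧ m • y ≤ x

/-- `x` is weakly `(m, ω)`-divisible. -/
def IsWeaklyOmegaDivisible (m : ℕ) (x : S) : Prop :=
  ∀ x' : S, WayBelow x' x → ∃ (n : ℕ) (y : Fin n → S), x' ≤ ∑ j, y j ∧ ∀ j, m • y j ≤ x

/-- `x` is `(m, ω)`-divisible. -/
def IsOmegaDivisible (m : ℕ) (x : S) : Prop :=
  ∀ x' : S, WayBelow x' x → ∃ (y : S) (n : ℕ), x' ≤ n • y ∧ m • y ≤ x

/-- `wdiv m x` is the least positive integer `n` such that `x` is weakly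
`(m,n)`-divisible, and `∞` if there is no such `n`. -/
def wdiv (m : ℕ) (x : S) : ℕ∞ :=
  sInf {N : ℕ∞ | ∃ n : ℕ, 1 ≤ n ∧ N = n ∧ IsWeaklyDivisible m n x}

/-- `Div m x` is the least positive integer `n` such that `x` is `(m,n)`-divisible,
and `∞` if there is no such `n`. -/
def Div (m : ℕ) (x : S) : ℕ∞ :=
  sInf {N : ℕ∞ | ∃ n : ℕ, 1 ≤ n ∧ N = n ∧ IsDivisible m n x}

/-- An element `x` is strongly soft if for every `x' ≪ x` there is `t` with
`x' + t ≤ x ≤ ∞t`. -/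
def StronglySoft (x : S) : Prop :=
  ∀ x' : S, WayBelow x' x → ∃ t : S, x' + t ≤ x ∧ x ≤ CuSemigroup.infty t

/-- The Cuntz semigroup characterization of the Global Glimm Property: every element is
`(m, ω)`-divisible for every `m`. -/
def GlobalGlimm (S : Type*) [CuSemigroup S] : Prop :=
  ∀ (m : ℕ) (x : S), IsOmegaDivisible m x

/-- `Cu(A)` is left-soft separative. -/
def LeftSoftSeparative (S : Type*) [CuSemigroup S] : Prop :=
  ∀ x y t : S, StronglySoft x → WayBelow (x + t) (y + t) →
    WayBelow t (CuSemigroup.infty y) → WayBelow t (CuSemigroup.infty x) → WayBelow x y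

/-- `Cu(A)` is weakly cancellative. -/
def WeaklyCancellative (S : Type*) [CuSemigroup S] : Prop :=
  ∀ x y z : S, WayBelow (x + z) (y + z) → WayBelow x y

/-- `Cu(A)` has covering dimension zero. -/
def CoveringDimZero (S : Type*) [CuSemigroup S] : Prop :=
  ∀ x' x y₁ y₂ : S, WayBelow x' x → WayBelow x (y₁ + y₂) →
    ∃ z₁ z₂ : S, z₁ ≤ y₁ ∧ z₂ ≤ y₂ ∧ x' ≤ z₁ + z₂ ∧ z₁ + z₂ ≤ x

end CuDiv

/-- A functional on a Cuntz semigroup: an additive, order preserving map to `ℝ≥0∞`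
preserving suprema of increasing sequences.  (By Elliott–Robert–Santiago, the
functionals on `Cu(A)` are exactly those induced by the lower semicontinuous
2-quasitraces on `A ⊗ K`.) -/
structure CuFunctional (S : Type*) [CuSemigroup S] where
  toFun : S → ℝ≥0∞
  map_zero' : toFun 0 = 0
  map_add' : ∀ x y : S, toFun (x + y) = toFun x + toFun y
  mono' : ∀ x y : S, x ≤ y → toFun x ≤ toFun y
  sup' : ∀ f : ℕ → S, Monotone f → ∀ s : S, IsLUB (Set.range f) s →
    toFun s = ⨆ n, toFun (f n)

instance {S : Type*} [CuSemigroup S] : CoeFun (CuFunctional S) fun _ => S → ℝ≥0∞ :=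
  ⟨CuFunctional.toFun⟩

namespace CuDiv

variable {S : Type*} [CuSemigroup S]

/-- `x <ₛ y` : there is `γ < 1` with `λ(x) ≤ γ·λ(y)` for every functional `λ`. -/
def FunctionalLT (x y : S) : Prop :=
  ∃ γ : ℝ≥0∞, γ < 1 ∧ ∀ lam : CuFunctional S, lam x ≤ γ * lam y

/-- `A` has `k`-comparison (stated on `Cu(A)`). -/
def KComparison (S : Type*) [CuSemigroup S] (k : ℕ) : Prop :=
  ∀ (x : S) (b : Fin (k + 1) → S), (∀ i, FunctionalLT x (b i)) → x ≤ ∑ i, b i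

/-- `A` has strict comparison (stated on `Cu(A)`, via functionals, which correspond to
the lower semicontinuous 2-quasitraces). -/
def StrictComparison (S : Type*) [CuSemigroup S] : Prop :=
  ∀ x y : S, FunctionalLT x y → x ≤ y

/-- The natural topology on the cone `F(Cu(A))` of functionals. -/
def functionalTopology (S : Type*) [CuSemigroup S] : TopologicalSpace (CuFunctional S) :=
  TopologicalSpace.generateFrom
    ({U | ∃ (x : S) (r : ℝ≥0∞), U = {lam : CuFunctional S | r < lam x}} ∪
      {U | ∃ (x' x : S) (r : ℝ≥0∞), WayBelow x' x ∧ U = {lam : CuFunctional S | lam x' < r}})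

/-- A lower semicontinuous affine function on the cone of functionals of `Cu(A)`,
i.e. an element of `L(F(Cu(A)))`. -/
def IsLscAffine (F : CuFunctional S → ℝ≥0∞) : Prop :=
  (letI := functionalTopology S; LowerSemicontinuous F) ∧
    (∀ lam mu nu : CuFunctional S, (∀ x, nu x = lam x + mu x) → F nu = F lam + F mu) ∧
    (∀ (r : ℝ≥0∞) (lam nu : CuFunctional S), (∀ x, nu x = r * lam x) → F nu = r * F lam)

/-- The rank map of `Cu(A)` is surjective: every lower semicontinuous affine function on
the cone of functionals is realized as the rank function `λ ↦ λ(x)` of an element. -/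
def SurjectiveRankMap (S : Type*) [CuSemigroup S] : Prop :=
  ∀ F : CuFunctional S → ℝ≥0∞, IsLscAffine F → ∃ y : S, ∀ lam : CuFunctional S, lam y = F lam

end CuDiv

/-! ### C*-algebra notions -/

section CStar

variable {B : Type*} [NonUnitalCStarAlgebra B]

/-- Positivity in a C*-algebra: `a` is positive iff it is of the form `star b * b`. -/
def CStarNonneg (a : B) : Prop := ∃ b : B, a = star b * b

/-- Cuntz subequivalence `a ≼ b` : `a = lim_n rₙ b rₙ*`. -/
def CuntzBelow (a b : B) : Prop :=
  ∃ r : ℕ → B, Tendsto (fun n => r n * b * star (r n)) atTop (𝓝 a)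

/-- Cuntz equivalence. -/
def CuntzEquiv (a b : B) : Prop := CuntzBelow a b ∧ CuntzBelow b a

/-- `A` is σ-unital: it has a countable (norm-bounded, positive) approximate unit. -/
def SigmaUnital (A : Type*) [NonUnitalCStarAlgebra A] : Prop :=
  ∃ e : ℕ → A, (∀ n, CStarNonneg (e n) ∧ ‖e n‖ ≤ 1) ∧
    ∀ a : A, Tendsto (fun n => e n * a) atTop (𝓝 a) ∧ Tendsto (fun n => a * e n) atTop (𝓝 a)

end CStar

/-- A closed two-sided (automatically star-closed) ideal of a C*-algebra. -/
structure ClosedTwoSidedIdealC (A : Type*) [NonUnitalCStarAlgebra A] where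
  carrier : NonUnitalStarSubalgebra ℂ A
  isClosed : IsClosed (carrier : Set A)
  mul_mem_left : ∀ a : A, ∀ x ∈ carrier, a * x ∈ carrier
  mul_mem_right : ∀ a : A, ∀ x ∈ carrier, x * a ∈ carrier

section Reps

variable {A : Type*} [NonUnitalCStarAlgebra A]
variable {H : Type*} [NormedAddCommGroup H] [InnerProductSpace ℂ H] [CompleteSpace H]

/-- A (topologically) irreducible representation of `A` on a Hilbert space `H`. -/
def IsIrreducibleRep (π : A →⋆ₙₐ[ℂ] (H →L[ℂ] H)) : Prop :=
  (∃ a : A, π a ≠ 0) ∧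
    ∀ K : Submodule ℂ H, IsClosed (K : Set H) → (∀ a : A, ∀ v ∈ K, π a v ∈ K) →
      K = ⊥ ∨ K = ⊤

end Reps

/-- `A` has a nonzero elementary ideal-quotient `J/I`, expressed via a surjection of a
closed two-sided ideal `J` of `A` onto the algebra of compact operators on a Hilbert
space (the kernel `I` of such a `*`-homomorphism is automatically a closed two-sided
ideal of `A`, and conversely any nonzero elementary ideal-quotient arises this way). -/
def HasNonzeroElementaryIdealQuotient (A : Type*) [NonUnitalCStarAlgebra A] : Prop :=
  ∃ (J : ClosedTwoSidedIdealC A) (H : Type) (_ : NormedAddCommGroup H)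
    (_ : InnerProductSpace ℂ H) (_ : CompleteSpace H)
    (ψ : J.carrier →⋆ₙₐ[ℂ] (H →L[ℂ] H)),
      Set.range ψ = {T : H →L[ℂ] H | IsCompactOperator ⇑T} ∧ ∃ x, ψ x ≠ 0

/-- A C*-algebra is nowhere scattered if no ideal-quotient of it is nonzero and
elementary. -/
def NowhereScattered (A : Type*) [NonUnitalCStarAlgebra A] : Prop :=
  ¬ HasNonzeroElementaryIdealQuotient A

/-- A C*-algebra is elementary if it is isomorphic to the algebra of compact operators
on some Hilbert space. -/
def IsElementaryCStar (A : Type*) [NonUnitalCStarAlgebra A] : Prop :=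
  ∃ (H : Type) (_ : NormedAddCommGroup H) (_ : InnerProductSpace ℂ H) (_ : CompleteSpace H)
    (ψ : A →⋆ₙₐ[ℂ] (H →L[ℂ] H)),
      Function.Injective ψ ∧ Set.range ψ = {T : H →L[ℂ] H | IsCompactOperator ⇑T}

/-- A C*-algebra is simple if it is nonzero and has no nontrivial closed two-sided
ideals. -/
def IsSimpleCStar (A : Type*) [NonUnitalCStarAlgebra A] : Prop :=
  (∃ a : A, a ≠ 0) ∧
    ∀ J : ClosedTwoSidedIdealC A, (J.carrier : Set A) = {0} ∨ (J.carrier : Set A) = Set.univ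

/-- Real rank zero: the invertible self-adjoint elements are dense in the self-adjoint
part of the minimal unitization. -/
def RealRankZero (A : Type*) [NonUnitalCStarAlgebra A] : Prop :=
  ∀ x : Unitization ℂ A, IsSelfAdjoint x →
    x ∈ closure {y : Unitization ℂ A | IsSelfAdjoint y ∧ IsUnit y}

/-- Stable rank one: the invertible elements are dense in the minimal unitization. -/
def StableRankOne (A : Type*) [NonUnitalCStarAlgebra A] : Prop :=
  ∀ x : Unitization ℂ A, x ∈ closure {y : Unitization ℂ A | IsUnit y}

section CP

variable {A B : Type*} [NonUnitalCStarAlgebra A] [NonUnitalCStarAlgebra B]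

/-- A linear map between C*-algebras is completely positive if all of its matrix
amplifications preserve positivity. -/
def IsCompletelyPositive (φ : A →ₗ[ℂ] B) : Prop :=
  ∀ (n : ℕ) (a : Matrix (Fin n) (Fin n) A), (∃ b : Matrix (Fin n) (Fin n) A, a = star b * b) →
    ∃ c : Matrix (Fin n) (Fin n) B, a.map ⇑φ = star c * c

/-- A completely positive contractive (c.p.c.) map. -/
def IsCPC (φ : A →ₗ[ℂ] B) : Prop :=
  IsCompletelyPositive φ ∧ ∀ a : A, ‖φ a‖ ≤ ‖a‖

/-- A map between C*-algebras has order zero if it preserves orthogonality of positive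
elements. -/
def IsOrderZero (φ : A →ₗ[ℂ] B) : Prop :=
  ∀ a b : A, CStarNonneg a → CStarNonneg b → a * b = 0 → φ a * φ b = 0

end CP

/-- `A` has nuclear dimension at most `k`: there are c.p.c. approximations of the
identity through finite dimensional C*-algebras in which the downwards maps are sums of
`k+1` c.p.c. order zero maps. -/
def NuclearDimLE (A : Type*) [NonUnitalCStarAlgebra A] (k : ℕ) : Prop :=
  ∀ (F : Finset A) (ε : ℝ), 0 < ε →
    ∃ (Fd : Type) (_ : NonUnitalCStarAlgebra Fd) (_ : FiniteDimensional ℂ Fd)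
      (ψ : A →ₗ[ℂ] Fd) (φ : Fin (k + 1) → (Fd →ₗ[ℂ] A)),
        IsCPC ψ ∧ (∀ i, IsCPC (φ i) ∧ IsOrderZero (φ i)) ∧
        ∀ a ∈ F, ‖(∑ i, φ i (ψ a)) - a‖ ≤ ε

section Prim

variable (A : Type*) [NonUnitalCStarAlgebra A]

/-- A primitive ideal: the kernel of an irreducible representation. -/
def IsPrimitiveIdeal {A : Type*} [NonUnitalCStarAlgebra A] (J : ClosedTwoSidedIdealC A) : Prop :=
  ∃ (H : Type) (_ : NormedAddCommGroup H) (_ : InnerProductSpace ℂ H) (_ : CompleteSpace H)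
    (π : A →⋆ₙₐ[ℂ] (H →L[ℂ] H)),
      IsIrreducibleRep π ∧ ∀ a : A, a ∈ J.carrier ↔ π a = 0

/-- The primitive ideal space of `A`. -/
def PrimIdealSpace := {J : ClosedTwoSidedIdealC A // IsPrimitiveIdeal J}

/-- The hull-kernel (Jacobson) topology on the primitive ideal space. -/
instance : TopologicalSpace (PrimIdealSpace A) :=
  TopologicalSpace.generateFrom {U | ∃ a : A, U = {P : PrimIdealSpace A | a ∉ P.1.carrier}}

/-- `A` has topological dimension zero: the primitive ideal space has a basis of
compact open sets. -/
def TopDimZero : Prop :=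
  ∃ 𝒷 : Set (Set (PrimIdealSpace A)), TopologicalSpace.IsTopologicalBasis 𝒷 ∧
    ∀ U ∈ 𝒷, IsCompact U ∧ IsOpen U

end Prim

section Proj

variable {B : Type*} [NonUnitalCStarAlgebra B]

/-- A projection in a C*-algebra. -/
def IsProjectionElem (p : B) : Prop := IsSelfAdjoint p ∧ p * p = p

/-- `B` contains an infinite projection: a projection which is Murray-von Neumann
equivalent to a proper subprojection of itself. -/
def HasInfiniteProjection (B : Type*) [NonUnitalCStarAlgebra B] : Prop :=
  ∃ p v : B, IsProjectionElem p ∧ star v * v = p ∧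
    p * (v * star v) = v * star v ∧ v * star v ≠ p

end Proj

/-! ### The Cuntz semigroup of a C*-algebra -/

/-- Padding a matrix by one extra row and column of zeros. -/
def matPad {A : Type*} [Zero A] {n : ℕ} (a : Matrix (Fin n) (Fin n) A) :
    Matrix (Fin (n + 1)) (Fin (n + 1)) A :=
  Matrix.of fun i j =>
    if h : (i : ℕ) < n ∧ (j : ℕ) < n then a ⟨i, h.1⟩ ⟨j, h.2⟩ else 0

/-- A witness that `S` is the Cuntz semigroup of the C*-algebra `A`: it provides a
stabilization `stab` of `A` (a model of `A ⊗ K`, described as the C*-completion of the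
union of the matrix algebras `Mₙ(A)`), together with the class map
`cls : (stab)₊ → S = Cu(A)` identifying `S` with the set of Cuntz equivalence classes of
positive elements of `A ⊗ K`, with order induced by Cuntz subequivalence, addition
induced by orthogonal (diagonal) addition, and with the compact containment relation
`≪` given by `x ≪ [a]` iff `x ≤ [(a - ε)₊]` for some `ε > 0`. -/
structure IsCuntzSemigroupOf (A : Type uu) [NonUnitalCStarAlgebra A]
    (S : Type vv) [CuSemigroup S] where
  stab : Type (max uu vv)
  [stabCStar : NonUnitalCStarAlgebra stab]
  matEmb : (n : ℕ) → (Matrix (Fin n) (Fin n) A →⋆ₙₐ[ℂ] stab)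
  matEmb_injective : ∀ n, Function.Injective (matEmb n)
  matEmb_compat : ∀ (n : ℕ) (a : Matrix (Fin n) (Fin n) A), matEmb (n + 1) (matPad a) = matEmb n a
  matEmb_dense : Dense (⋃ n, Set.range (matEmb n))
  cls : stab → S
  cls_zero : cls 0 = 0
  cls_surj : ∀ s : S, ∃ b : stab, CStarNonneg b ∧ cls b = s
  cls_le_iff : ∀ a b : stab, CStarNonneg a → CStarNonneg b → (cls a ≤ cls b ↔ CuntzBelow a b)
  cls_add_orth : ∀ a b : stab, CStarNonneg a → CStarNonneg b → a * b = 0 →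
    cls (a + b) = cls a + cls b
  exists_orth : ∀ a b : stab, CStarNonneg a → CStarNonneg b →
    ∃ a' b' : stab, CStarNonneg a' ∧ CStarNonneg b' ∧ a' * b' = 0 ∧
      cls a' = cls a ∧ cls b' = cls b
  waybelow_iff : ∀ (x : S) (a : stab), CStarNonneg a →
    (WayBelow x (cls a) ↔ ∃ ε : ℝ, 0 < ε ∧ x ≤ cls (cfcₙ (fun t : ℝ => max (t - ε) 0) a))

attribute [instance] IsCuntzSemigroupOf.stabCStar

/-- The Cuntz class `[a] ∈ Cu(A)` of an element `a` of `A` itself (via the canonical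
embedding `A ≅ M₁(A) ⊆ A ⊗ K`). -/
def IsCuntzSemigroupOf.clsA {A : Type*} [NonUnitalCStarAlgebra A] {S : Type*} [CuSemigroup S]
    (h : IsCuntzSemigroupOf A S) (a : A) : S :=
  h.cls (h.matEmb 1 (Matrix.of fun _ _ => a))

/-- `B` has a surjective rank map (every lower semicontinuous affine function on the
cone of functionals on `Cu(B)` is realized as a rank function). -/
def HasSurjectiveRankMap (B : Type*) [NonUnitalCStarAlgebra B] : Prop :=
  ∀ (S : Type) (inst : CuSemigroup S), IsCuntzSemigroupOf B S → CuDiv.SurjectiveRankMap S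

/-- The family of separable sub-C*-algebras of `A` having a surjective rank map. -/
def sepSurjRankFamily (A : Type*) [NonUnitalCStarAlgebra A] :
    Set (NonUnitalStarSubalgebra ℂ A) :=
  {B | ∃ _h : IsClosed (B : Set A),
    TopologicalSpace.SeparableSpace B ∧ HasSurjectiveRankMap B}

/-- The family of separable sub-C*-algebras of `A` with a surjective rank map is
σ-complete (closed under countable increasing unions) and cofinal (every separable
sub-C*-algebra is contained in a member). -/
def SepSurjRankFamilySigmaCompleteCofinal (A : Type*) [NonUnitalCStarAlgebra A] : Prop :=
  (∀ Bseq : ℕ → NonUnitalStarSubalgebra ℂ A, Monotone Bseq →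
    (∀ n, Bseq n ∈ sepSurjRankFamily A) →
      (⨆ n, Bseq n).topologicalClosure ∈ sepSurjRankFamily A) ∧
  (∀ C : NonUnitalStarSubalgebra ℂ A, IsClosed (C : Set A) →
    TopologicalSpace.SeparableSpace C → ∃ B ∈ sepSurjRankFamily A, C ≤ B)

end

theorem exists_maximal_twoSided_ideal_disjoint {R : Type*} [Ring R] (I₀ : Ideal R)
    (hI₀ : I₀.IsTwoSided) (T : Set R) (hT : Disjoint (I₀ : Set R) T) :
    ∃ P : Ideal R, P.IsTwoSided ∧ I₀ ≤ P ∧ Disjoint (P : Set R) T ∧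
      ∀ Q : Ideal R, Q.IsTwoSided → P ≤ Q → Disjoint (Q : Set R) T → Q ≤ P := by
  obtain ⟨P, hIP, hP⟩ := zorn_le_nonempty₀
    {P : Ideal R | P.IsTwoSided ∧ Disjoint (P : Set R) T} (fun c hc hch y hy => by
      have hne : c.Nonempty := ⟨y, hy⟩
      have hmem : ∀ x, x ∈ sSup c ↔ ∃ J ∈ c, x ∈ J := fun x =>
        Submodule.mem_sSup_of_directed hne hch.directedOn
      refine ⟨sSup c, ⟨⟨fun {a} b ha => ?_⟩, ?_⟩, fun z hz => le_sSup hz⟩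
      · obtain ⟨J, hJ, haJ⟩ := (hmem a).1 ha
        exact (hmem _).2 ⟨J, hJ, (hc hJ).1.mul_mem_of_left b haJ⟩
      · rw [Set.disjoint_left]
        intro x hx hxT
        obtain ⟨J, hJ, hxJ⟩ := (hmem x).1 hx
        exact Set.disjoint_left.1 (hc hJ).2 hxJ hxT) I₀ ⟨hI₀, hT⟩
  exact ⟨P, hP.1.1, hIP, hP.1.2, fun Q hQ hPQ hQT => hP.2 ⟨hQ, hQT⟩ hPQ⟩

/-- A two-sided ideal maximal among those avoiding an `m`-system is prime. -/
theorem mem_or_mem_of_maximal_disjoint {R : Type*} [Ring R] {P : Ideal R} (hP : P.IsTwoSided)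
    {T : Set R} (hPT : Disjoint (P : Set R) T)
    (hmax : ∀ Q : Ideal R, Q.IsTwoSided → P ≤ Q → Disjoint (Q : Set R) T → Q ≤ P)
    (hT : ∀ s ∈ T, ∀ t ∈ T, ∃ c, s * c * t ∈ T) {u v : R} (huv : ∀ c, u * c * v ∈ P) :
    u ∈ P ∨ v ∈ P := by
  by_contra! hcon
  obtain ⟨hu, hv⟩ := hcon
  have meets : ∀ Q : Ideal R, Q.IsTwoSided → P ≤ Q → ¬ Q ≤ P → ∃ s ∈ T, s ∈ Q := by
    intro Q hQ hPQ hQP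
    by_contra! h
    exact hQP (hmax Q hQ hPQ (Set.disjoint_left.2 fun x hx hxT => h x hxT hx))
  let Q₁ : Ideal R :=
    { carrier := {y | ∀ c, y * c * v ∈ P}
      add_mem' := fun {x y} hx hy c => by simpa [add_mul] using P.add_mem (hx c) (hy c)
      zero_mem' := fun c => by simp
      smul_mem' := fun r y hy c => by simpa [mul_assoc] using P.mul_mem_left r (hy c) }
  obtain ⟨s, hsT, hs⟩ := meets Q₁
    ⟨fun {y} r hy c => by simpa [mul_assoc] using hy (r * c)⟩
    (fun y hy c => hP.mul_mem_of_left _ (hP.mul_mem_of_left _ hy))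
    (fun h => hu (h huv))
  let Q₂ : Ideal R :=
    { carrier := {y | ∀ c, s * c * y ∈ P}
      add_mem' := fun {x y} hx hy c => by simpa [mul_add] using P.add_mem (hx c) (hy c)
      zero_mem' := fun c => by simp
      smul_mem' := fun r y hy c => by simpa [mul_assoc] using hy (c * r) }
  obtain ⟨t, htT, ht⟩ := meets Q₂
    ⟨fun {y} r hy c => by simpa [mul_assoc] using hP.mul_mem_of_left r (hy c)⟩
    (fun y hy c => P.mul_mem_left _ hy)
    (fun h => hv (h hs))
  obtain ⟨c, hc⟩ := hT s hsT t htT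
  exact Set.disjoint_left.1 hPT (ht c) hc

section

variable {R : Type*} [CStarAlgebra R]

/-- `(α - δ)₊`. -/
noncomputable abbrev cutDown (α : R) (δ : ℝ) : R := cfc (fun t : ℝ => max (t - δ) 0) α

theorem exists_cutDown_mul_mul_cutDown {α : R} {δ₁ δ₂ δ : ℝ} (h₁ : δ₁ < δ)
    (h₂ : δ₂ < δ) : ∃ c, cutDown α δ₁ * c * cutDown α δ₂ = cutDown α δ := by
  have hk : Continuous fun t : ℝ =>
      max (t - δ) 0 / (max (t - δ₁) (δ - δ₁) * max (t - δ₂) (δ - δ₂)) := by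
    refine Continuous.div (by fun_prop) (by fun_prop) fun t => ?_
    exact mul_ne_zero (lt_max_of_lt_right (by linarith)).ne' (lt_max_of_lt_right (by linarith)).ne'
  refine ⟨cfc (fun t : ℝ =>
      max (t - δ) 0 / (max (t - δ₁) (δ - δ₁) * max (t - δ₂) (δ - δ₂))) α, ?_⟩
  rw [← cfc_mul _ _ α (by fun_prop) hk.continuousOn,
    ← cfc_mul _ _ α (by fun_prop) (by fun_prop)]
  congr 1
  funext t
  rcases le_total t δ with h | h
  · simp [max_eq_right (sub_nonpos.2 h)]
  · rw [max_eq_left (by linarith : (0 : ℝ) ≤ t - δ), max_eq_left (by linarith : (0 : ℝ) ≤ t - δ₁),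
      max_eq_left (by linarith : (0 : ℝ) ≤ t - δ₂),
      max_eq_left (by linarith : δ - δ₁ ≤ t - δ₁), max_eq_left (by linarith : δ - δ₂ ≤ t - δ₂)]
    have : t - δ₁ ≠ 0 := by linarith
    have : t - δ₂ ≠ 0 := by linarith
    field_simp

theorem cutDown_mem_of_mem_closure {P : Ideal R} (hP : P.IsTwoSided) {α : R}
    (hα : IsSelfAdjoint α) {δ δ' : ℝ} (hδ : δ < δ') (h : cutDown α δ ∈ closure (P : Set R)) :
    cutDown α δ' ∈ P := by
  nontriviality R
  set m := δ' - δ with hm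
  have hm0 : 0 < m := by linarith
  obtain ⟨p, hp, hpd⟩ := Metric.mem_closure_iff.1 h m hm0
  rw [dist_eq_norm] at hpd
  have hc : Continuous fun t : ℝ => (max (max (t - δ) 0) m)⁻¹ :=
    Continuous.inv₀ (by fun_prop) fun t => (lt_max_of_lt_right hm0).ne'
  let G : R := cfc (fun t : ℝ => max (max (t - δ) 0) m) α
  let G' : R := cfc (fun t : ℝ => (max (max (t - δ) 0) m)⁻¹) α
  have hG'G : G * G' = 1 := by
    rw [← cfc_mul _ _ α (by fun_prop) hc.continuousOn, ← cfc_one ℝ α]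
    congr 1
    funext t
    exact mul_inv_cancel₀ (lt_max_of_lt_right hm0).ne'
  have hG' : ‖G'‖ ≤ m⁻¹ := norm_cfc_le (by positivity) fun t _ => by
    rw [Real.norm_eq_abs, abs_of_nonneg (by positivity)]
    exact inv_anti₀ hm0 (le_max_right _ _)
  have hunit : IsUnit (1 - G' * (cutDown α δ - p)) := by
    apply isUnit_one_sub_of_norm_lt_one
    calc ‖G' * (cutDown α δ - p)‖ ≤ ‖G'‖ * ‖cutDown α δ - p‖ := norm_mul_le _ _
      _ ≤ m⁻¹ * ‖cutDown α δ - p‖ := by gcongr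
      _ < m⁻¹ * m := by gcongr
      _ = 1 := inv_mul_cancel₀ hm0.ne'
  have hq : cutDown α δ' * (G - cutDown α δ) = 0 := by
    rw [← cfc_sub _ _ α (by fun_prop) (by fun_prop), ← cfc_mul _ _ α (by fun_prop) (by fun_prop),
      ← cfc_zero ℝ α]
    congr 1
    funext t
    rcases le_total t δ' with h | h
    · simp [max_eq_right (sub_nonpos.2 h)]
    · rw [max_eq_left (by linarith : (0 : ℝ) ≤ t - δ), max_eq_left (by linarith : m ≤ t - δ)]
      simp
  obtain ⟨w, hw⟩ := hunit.exists_right_inv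
  have hkey : cutDown α δ' * G * (1 - G' * (cutDown α δ - p)) = cutDown α δ' * p := by
    have : cutDown α δ' * G = cutDown α δ' * cutDown α δ := by
      rw [← sub_eq_zero, ← mul_sub, hq]
    calc cutDown α δ' * G * (1 - G' * (cutDown α δ - p))
        = cutDown α δ' * G - cutDown α δ' * (G * G') * (cutDown α δ - p) := by noncomm_ring
      _ = cutDown α δ' * p := by rw [hG'G, this]; noncomm_ring
  have hGP : cutDown α δ' * G ∈ P := by
    rw [← mul_one (cutDown α δ' * G), ← hw, ← mul_assoc, hkey]
    exact hP.mul_mem_of_left _ (P.mul_mem_left _ hp)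
  rw [← mul_one (cutDown α δ'), ← hG'G, ← mul_assoc]
  exact hP.mul_mem_of_left _ hGP

/-- A closed prime ideal avoiding the elements `(α - δ)₊`, `δ < ε`. -/
theorem exists_closed_prime_ideal {α : R} (hα : IsSelfAdjoint α) {ε : ℝ} (I₀ : Ideal R)
    (hI₀ : I₀.IsTwoSided) (h : ∀ δ, 0 < δ → δ < ε → cutDown α δ ∉ I₀) :
    ∃ P : Ideal R, P.IsTwoSided ∧ I₀ ≤ P ∧ IsClosed (P : Set R) ∧
      (∀ δ, 0 < δ → δ < ε → cutDown α δ ∉ P) ∧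
      ∀ u v : R, (∀ c, u * c * v ∈ P) → u ∈ P ∨ v ∈ P := by
  set T : Set R := {x | ∃ δ, 0 < δ ∧ δ < ε ∧ x = cutDown α δ}
  obtain ⟨P, hP, hIP, hPT, hmax⟩ := exists_maximal_twoSided_ideal_disjoint I₀ hI₀ T
    (Set.disjoint_left.2 fun x hx ⟨δ, h0, h1, hxδ⟩ => h δ h0 h1 (hxδ ▸ hx))
  have hnot : ∀ δ, 0 < δ → δ < ε → cutDown α δ ∉ P := fun δ h0 h1 hδ =>
    Set.disjoint_left.1 hPT hδ ⟨δ, h0, h1, rfl⟩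
  refine ⟨P, hP, hIP, ?_, hnot, fun u v huv => mem_or_mem_of_maximal_disjoint hP hPT hmax ?_ huv⟩
  · have hcl : (P.closure : Set R) = closure (P : Set R) := Ideal.coe_closure P
    have hQ : P.closure.IsTwoSided := ⟨fun {x} b hx => by
      have hx' : x ∈ closure (P : Set R) := hx
      exact map_mem_closure (f := fun y => y * b) (by fun_prop) hx'
        fun y hy => hP.mul_mem_of_left b hy⟩
    have hle := hmax P.closure hQ (fun x hx => subset_closure hx) (Set.disjoint_left.2 ?_)
    · refine closure_subset_iff_isClosed.1 fun x hx => hle hx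
    · rintro x hx ⟨δ, h0, h1, rfl⟩
      exact hnot ((δ + ε) / 2) (by linarith) (by linarith)
        (cutDown_mem_of_mem_closure hP hα (by linarith) hx)
  · rintro _ ⟨δ₁, h1, h1', rfl⟩ _ ⟨δ₂, h2, h2', rfl⟩
    have hm : max δ₁ δ₂ < ε := max_lt h1' h2'
    have hl := le_max_left δ₁ δ₂
    have hr := le_max_right δ₁ δ₂
    obtain ⟨c, hc⟩ := exists_cutDown_mul_mul_cutDown (α := α)
      (show δ₁ < (max δ₁ δ₂ + ε) / 2 by linarith) (show δ₂ < (max δ₁ δ₂ + ε) / 2 by linarith)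
    exact ⟨c, (max δ₁ δ₂ + ε) / 2, by linarith, by linarith, hc⟩

end

section

variable {R : Type*} [CStarAlgebra R]

theorem continuous_cfc_max_sub (f : ℝ → ℝ) (hf : ∀ s t, |f s - f t| ≤ |s - t|) (x : R) :
    Continuous fun t : ℝ => cfc (fun s : ℝ => f (s - t)) x := by
  have hfc : Continuous f := (LipschitzWith.of_dist_le_mul (K := 1) fun s t => by
    simpa [Real.dist_eq] using hf s t).continuous
  refine (LipschitzWith.of_dist_le_mul (K := 1) fun s t => ?_).continuous
  rw [dist_eq_norm, ← cfc_sub _ _ x (by fun_prop) (by fun_prop), Real.dist_eq, NNReal.coe_one,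
    one_mul]
  refine norm_cfc_le (abs_nonneg _) fun r _ => ?_
  refine (hf _ _).trans (le_of_eq ?_)
  rw [abs_sub_comm]
  congr 1
  ring

/-- Modulo a closed ideal `P` containing one of `(x - t)₊`, `(x - t)₋` for each `t`,
the self-adjoint element `x` is a scalar. -/
theorem exists_real_sub_algebraMap_mem {P : Ideal R} (hcl : IsClosed (P : Set R))
    (hP1 : (1 : R) ∉ P) {x : R} (hx : IsSelfAdjoint x)
    (h : ∀ t : ℝ, cfc (fun s : ℝ => max (s - t) 0) x ∈ P ∨
      cfc (fun s : ℝ => max (-(s - t)) 0) x ∈ P) :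
    ∃ l : ℝ, x - algebraMap ℝ R l ∈ P := by
  have : Nontrivial R := nontrivial_of_ne 1 0 fun h10 => hP1 (h10 ▸ P.zero_mem)
  have hdec : ∀ t : ℝ, x - algebraMap ℝ R t =
      cfc (fun s : ℝ => max (s - t) 0) x - cfc (fun s : ℝ => max (-(s - t)) 0) x := by
    intro t
    rw [← cfc_sub _ _ x (by fun_prop) (by fun_prop)]
    conv_lhs => rw [← cfc_id' ℝ x, ← cfc_const t x, ← cfc_sub _ _ x (by fun_prop) (by fun_prop)]
    congr 1
    funext s
    rcases le_total s t with hs | hs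
    · rw [max_eq_right (by linarith), max_eq_left (by linarith)]; ring
    · rw [max_eq_left (by linarith), max_eq_right (by linarith)]; ring
  have hc1 := continuous_cfc_max_sub (fun r : ℝ => max r 0)
    (fun s t => by simpa using abs_max_sub_max_le_abs s t 0) x
  have hc2 := continuous_cfc_max_sub (fun r : ℝ => max (-r) 0)
    (fun s t => by
      refine (abs_max_sub_max_le_abs (-s) (-t) 0).trans (le_of_eq ?_)
      rw [← abs_neg]; congr 1; ring) x
  set E : Set ℝ := {t | cfc (fun s : ℝ => max (s - t) 0) x ∉ P} with hE
  have hmono : ∀ {s t : ℝ}, s < t → cfc (fun r : ℝ => max (r - s) 0) x ∈ P →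
      cfc (fun r : ℝ => max (r - t) 0) x ∈ P := by
    intro s t hst hs
    obtain ⟨c, hc⟩ : ∃ c : R, c * cfc (fun r : ℝ => max (r - s) 0) x =
        cfc (fun r : ℝ => max (r - t) 0) x := by
      have hk : Continuous fun r : ℝ => max (r - t) 0 / max (r - s) (t - s) :=
        Continuous.div (by fun_prop) (by fun_prop) fun r =>
          (lt_max_of_lt_right (by linarith)).ne'
      refine ⟨cfc (fun r : ℝ => max (r - t) 0 / max (r - s) (t - s)) x, ?_⟩
      rw [← cfc_mul _ _ x hk.continuousOn (by fun_prop)]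
      congr 1
      funext r
      rcases le_total r t with h | h
      · simp [max_eq_right (sub_nonpos.2 h)]
      · rw [max_eq_left (by linarith : (0 : ℝ) ≤ r - s), max_eq_left (by linarith : t - s ≤ r - s)]
        have : r - s ≠ 0 := by linarith
        field_simp
    exact hc ▸ P.mul_mem_left c hs
  have hbdd : ∀ t ∈ E, t ≤ ‖x‖ := by
    intro t ht
    by_contra! hlt
    apply ht
    have : cfc (fun s : ℝ => max (s - t) 0) x = 0 := by
      rw [← cfc_zero ℝ x]
      refine cfc_congr fun s hs => ?_
      have := (le_abs_self s).trans (spectrum.norm_le_norm_of_mem hs)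
      simp only [Pi.zero_apply]
      exact max_eq_right (by linarith)
    rw [this]
    exact P.zero_mem
  have hneg : (-‖x‖ - 1) ∈ E := by
    intro hmem
    apply hP1
    obtain ⟨c, hc⟩ : ∃ c : R, c * cfc (fun s : ℝ => max (s - (-‖x‖ - 1)) 0) x = 1 := by
      have hk : Continuous fun r : ℝ => (max (r - (-‖x‖ - 1)) 1)⁻¹ :=
        Continuous.inv₀ (by fun_prop) fun r => (lt_max_of_lt_right one_pos).ne'
      refine ⟨cfc (fun r : ℝ => (max (r - (-‖x‖ - 1)) 1)⁻¹) x, ?_⟩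
      rw [← cfc_mul _ _ x hk.continuousOn (by fun_prop), ← cfc_one ℝ x]
      refine cfc_congr fun s hs => ?_
      have := (neg_le_abs s).trans (spectrum.norm_le_norm_of_mem hs)
      simp only [Pi.one_apply]
      rw [max_eq_left (by linarith), max_eq_left (by linarith)]
      exact inv_mul_cancel₀ (by linarith)
    exact hc ▸ P.mul_mem_left c hmem
  have hBA : BddAbove E := ⟨‖x‖, hbdd⟩
  refine ⟨sSup E, ?_⟩
  rw [hdec]
  refine P.sub_mem ?_ ?_
  · have hlim : Tendsto (fun t : ℝ => cfc (fun s : ℝ => max (s - t) 0) x) (𝓝[>] sSup E)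
        (𝓝 (cfc (fun s : ℝ => max (s - sSup E) 0) x)) :=
      (hc1.tendsto _).mono_left nhdsWithin_le_nhds
    refine hcl.mem_of_tendsto hlim (eventually_nhdsWithin_of_forall fun t ht => ?_)
    by_contra hn
    exact not_le.2 ht (le_csSup hBA hn)
  · have hlim : Tendsto (fun t : ℝ => cfc (fun s : ℝ => max (-(s - t)) 0) x) (𝓝[<] sSup E)
        (𝓝 (cfc (fun s : ℝ => max (-(s - sSup E)) 0) x)) :=
      (hc2.tendsto _).mono_left nhdsWithin_le_nhds
    refine hcl.mem_of_tendsto hlim (eventually_nhdsWithin_of_forall fun t ht => ?_)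
    obtain ⟨t', ht', htt'⟩ := exists_lt_of_lt_csSup ⟨_, hneg⟩ ht
    exact (h t).resolve_left fun hmem => ht' (hmono htt' hmem)

/-- A proper ideal modulo which every self-adjoint element is a scalar is the kernel of a
character. -/
theorem exists_character_of_scalar_mod {P : Ideal R} (hP : P.IsTwoSided) (hP1 : (1 : R) ∉ P)
    (h : ∀ x : R, IsSelfAdjoint x → ∃ l : ℝ, x - algebraMap ℝ R l ∈ P) :
    ∃ χ : R →⋆ₐ[ℂ] ℂ, ∀ x, χ x = 0 → x ∈ P := by
  have hex : ∀ x : R, ∃ l : ℂ, x - algebraMap ℂ R l ∈ P ∧ star x - algebraMap ℂ R (star l) ∈ P := by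
    intro x
    obtain ⟨l₁, h₁⟩ := h (realPart x) (realPart x).2
    obtain ⟨l₂, h₂⟩ := h (imaginaryPart x) (imaginaryPart x).2
    have e : ∀ l : ℝ, algebraMap ℝ R l = algebraMap ℂ R (l : ℂ) := fun l =>
      IsScalarTower.algebraMap_apply ℝ ℂ R l
    have hI : algebraMap ℂ R Complex.I * algebraMap ℂ R Complex.I = -1 := by
      rw [← map_mul]; simp
    rw [e] at h₁ h₂
    have hs : ∀ y : R, Complex.I • y = algebraMap ℂ R Complex.I * y := fun y =>
      Algebra.smul_def _ _
    have hx := realPart_add_I_smul_imaginaryPart x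
    rw [hs] at hx
    have hxs : star x = (realPart x : R) - algebraMap ℂ R Complex.I * (imaginaryPart x : R) := by
      conv_lhs => rw [← realPart_add_I_smul_imaginaryPart x]
      rw [star_add, star_smul, (realPart x).2.star_eq, (imaginaryPart x).2.star_eq, ← hs]
      simp [sub_eq_add_neg]
    refine ⟨l₁ + Complex.I * l₂, ?_, ?_⟩
    · have := P.add_mem h₁ (P.mul_mem_left (algebraMap ℂ R Complex.I) h₂)
      convert this using 1
      conv_lhs => rw [← hx]
      rw [map_add, map_mul]
      noncomm_ring
    · have := P.sub_mem h₁ (P.mul_mem_left (algebraMap ℂ R Complex.I) h₂)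
      convert this using 1
      rw [hxs]
      have : star ((l₁ : ℂ) + Complex.I * l₂) = l₁ - Complex.I * l₂ := by
        simp [sub_eq_add_neg]
      rw [this, map_sub, map_mul]
      noncomm_ring
  have huniq : ∀ l : ℂ, algebraMap ℂ R l ∈ P → l = 0 := by
    intro l hl
    by_contra hne
    apply hP1
    have := P.mul_mem_left (algebraMap ℂ R l⁻¹) hl
    rwa [← map_mul, inv_mul_cancel₀ hne, map_one] at this
  choose φ hφ hφs using hex
  have hval : ∀ x (l : ℂ), x - algebraMap ℂ R l ∈ P → φ x = l := by
    intro x l hl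
    have := P.sub_mem hl (hφ x)
    rw [sub_sub_sub_cancel_left, ← map_sub] at this
    exact sub_eq_zero.1 (huniq _ this)
  refine ⟨{ toFun := φ
            map_one' := hval _ _ (by simp)
            map_zero' := hval _ _ (by simp)
            map_mul' := fun x y => hval _ _ ?_
            map_add' := fun x y => hval _ _ ?_
            commutes' := fun r => hval _ _ (by simp)
            map_star' := fun x => hval _ _ (hφs x) }, fun x hx => ?_⟩
  · have := P.add_mem (P.mul_mem_left x (hφ y)) (hP.mul_mem_of_left (algebraMap ℂ R (φ y)) (hφ x))
    convert this using 1
    rw [map_mul]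
    noncomm_ring
  · have := P.add_mem (hφ x) (hφ y)
    convert this using 1
    rw [map_add]
    noncomm_ring
  · have := hφ x
    rw [show φ x = 0 from hx] at this
    simpa using this

end

section

variable {B : Type*} [NonUnitalCStarAlgebra B]

theorem Unitization.exists_inr_mul (k : B) (x : Unitization ℂ B) :
    ∃ k' : B, (k : Unitization ℂ B) * x = k' := by
  refine ⟨x.fst • k + k * x.snd, ?_⟩
  ext <;> simp

theorem Unitization.exists_mul_inr (x : Unitization ℂ B) (k : B) :
    ∃ k' : B, x * (k : Unitization ℂ B) = k' := by
  refine ⟨x.fst • k + x.snd * k, ?_⟩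
  ext <;> simp

theorem mul_star_mul_mem_of_polarization {R : Type*} [CStarAlgebra R] {P : Ideal R} {u v : R}
    (hz : ∀ c : R, (v * star c * u) * (u * c * v) ∈ P) (c d : R) :
    (v * star c * u) * (u * d * v) ∈ P := by
  have e1 := hz (c + d)
  have e2 := hz (c + Complex.I • d)
  have h1 : (v * star c * u) * (u * d * v) + (v * star d * u) * (u * c * v) ∈ P := by
    have := P.sub_mem (P.sub_mem e1 (hz c)) (hz d)
    convert this using 1
    rw [star_add]; noncomm_ring
  have h2 : Complex.I • ((v * star c * u) * (u * d * v)) -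
      Complex.I • ((v * star d * u) * (u * c * v)) ∈ P := by
    have := P.sub_mem (P.sub_mem e2 (hz c)) (hz d)
    convert this using 1
    simp only [star_add, star_smul, mul_add, add_mul, mul_smul_comm, smul_mul_assoc, smul_smul,
      Complex.star_def, Complex.conj_I, neg_smul, neg_mul, mul_neg,
      Complex.I_mul_I, neg_neg, one_smul, smul_add, smul_neg]
    abel
  have hsm : ∀ (t : ℂ) (w : R), w ∈ P → t • w ∈ P := fun t w hw => by
    rw [Algebra.smul_def]; exact P.mul_mem_left _ hw
  have h3 := P.add_mem h1 (hsm (-Complex.I) _ h2)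
  have h4 := hsm (2⁻¹) _ h3
  convert h4 using 1
  rw [smul_sub, smul_smul, smul_smul]
  simp only [neg_mul, Complex.I_mul_I, neg_neg, one_smul, add_add_sub_cancel]
  rw [← two_smul ℂ, smul_smul]
  norm_num

/-- If `Dom` contains the ideal generated by the squares `star y * y` of square-zero elements `y`,
then it contains `(a - ε)₊` unless the C*-algebra has a character. -/
theorem dom_cutDown_or_exists_character {a : B} (ha : IsSelfAdjoint a) {ε : ℝ} (hε : 0 < ε)
    (Dom : B → Prop) (h0 : Dom 0) (hadd : ∀ x y, Dom x → Dom y → Dom (x + y))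
    (hsq : ∀ y : B, y * y = 0 → ∀ k l : B, Dom (k * (star y * y) * l)) :
    Dom (cfcₙ (fun t : ℝ => max (t - ε) 0) a) ∨ ∃ χ : B →⋆ₙₐ[ℂ] ℂ, ∃ b, χ b ≠ 0 := by
  by_contra! hcon
  obtain ⟨hD, hχ⟩ := hcon
  let R := Unitization ℂ B
  let I₀ : Ideal R :=
    { carrier := {x | ∀ k l z : B, (k : R) * x * l = z → Dom z}
      add_mem' := fun {x y} hx hy k l z hz => by
        obtain ⟨k₁, hk₁⟩ := Unitization.exists_inr_mul k x
        obtain ⟨k₂, hk₂⟩ := Unitization.exists_inr_mul k y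
        have : z = k₁ * l + k₂ * l := by
          apply Unitization.inr_injective (R := ℂ)
          rw [← hz, mul_add, add_mul, hk₁, hk₂]
          simp
        rw [this]
        exact hadd _ _ (hx k l _ (by rw [hk₁]; simp)) (hy k l _ (by rw [hk₂]; simp))
      zero_mem' := fun k l z hz => by
        have : z = 0 := Unitization.inr_injective (R := ℂ) (by rw [← hz]; simp)
        rwa [this]
      smul_mem' := fun r x hx k l z hz => by
        obtain ⟨k', hk'⟩ := Unitization.exists_inr_mul k r
        refine hx k' l z ?_
        rw [← hz, ← hk', smul_eq_mul]
        simp only [mul_assoc] }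
  have hI₀ : I₀.IsTwoSided := ⟨fun {x} r hx k l z hz => by
    obtain ⟨l', hl'⟩ := Unitization.exists_mul_inr r l
    refine hx k l' z ?_
    rw [← hz, ← hl']
    simp only [mul_assoc]⟩
  have hα : IsSelfAdjoint (a : R) := by
    rw [isSelfAdjoint_iff, ← Unitization.inr_star, ha.star_eq]
  have hnot : ∀ δ, 0 < δ → δ < ε → cutDown (a : R) δ ∉ I₀ := by
    intro δ hδ hδε hmem
    apply hD
    set k : ℝ → ℝ := fun t => √(max (t - ε) 0 / max (t - δ) (ε - δ)) with hk
    have hkc : Continuous k := by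
      refine Continuous.sqrt (Continuous.div (by fun_prop) (by fun_prop) fun t => ?_)
      exact (lt_max_of_lt_right (by linarith)).ne'
    have hk0 : k 0 = 0 := by simp [hk, max_eq_right (by linarith : -ε ≤ 0)]
    refine hmem (cfcₙ k a) (cfcₙ k a) _ ?_
    rw [Unitization.real_cfcₙ_eq_cfc_inr a k hk0, Unitization.real_cfcₙ_eq_cfc_inr a _
      (by simp [hε.le]), cutDown,
      ← cfc_mul _ _ _ (by fun_prop) (by fun_prop), ← cfc_mul _ _ _ (by fun_prop) (by fun_prop)]
    congr 1
    funext t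
    have hmul : ∀ r s : ℝ, 0 ≤ r → √r * s * √r = r * s := fun r s hr => by
      rw [mul_right_comm, Real.mul_self_sqrt hr]
    rw [hk, hmul _ _ (div_nonneg (le_max_right _ _) (le_max_of_le_right (by linarith)))]
    rcases le_total t ε with h | h
    · simp [max_eq_right (sub_nonpos.2 h)]
    · rw [max_eq_left (by linarith : (0 : ℝ) ≤ t - δ), max_eq_left (by linarith : ε - δ ≤ t - δ)]
      have : t - δ ≠ 0 := by linarith
      field_simp
  obtain ⟨P, hP, hIP, hcl, hPnot, hprime⟩ := exists_closed_prime_ideal hα I₀ hI₀ hnot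
  have hP1 : (1 : R) ∉ P := fun h1 => hPnot (ε / 2) (by linarith) (by linarith) (by
    simpa using P.mul_mem_left (cutDown (a : R) (ε / 2)) h1)
  have hnil : ∀ y : R, y.fst = 0 → y * y = 0 → star y * y ∈ P := by
    intro y hy hyy
    apply hIP
    have hyi : y = (y.snd : R) := by
      ext <;> simp [hy]
    rw [hyi] at hyy ⊢
    intro k l z hz
    have e1 : y.snd * y.snd = 0 := Unitization.inr_injective (R := ℂ) (by simpa using hyy)
    have e2 : z = k * (star y.snd * y.snd) * l := Unitization.inr_injective (R := ℂ) (by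
      rw [← hz]; simp)
    rw [e2]
    exact hsq _ e1 k l
  have hpair : ∀ u v : R, IsSelfAdjoint u → IsSelfAdjoint v → u * v = 0 → v * u = 0 →
      u * u ∈ P ∨ v * v ∈ P := by
    intro u v hu hv huv hvu
    have hfst : u.fst * v.fst = 0 := by rw [← Unitization.fst_mul, huv, Unitization.fst_zero]
    have hz : ∀ c : R, (v * star c * u) * (u * c * v) ∈ P := by
      intro c
      have := hnil (u * c * v) (by
          rw [Unitization.fst_mul, Unitization.fst_mul, mul_right_comm, hfst, zero_mul])
        (by
          calc u * c * v * (u * c * v) = u * c * (v * u) * (c * v) := by noncomm_ring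
            _ = 0 := by rw [hvu]; simp)
      rw [star_mul, star_mul, hu.star_eq, hv.star_eq] at this
      simpa only [mul_assoc] using this
    have hpol := mul_star_mul_mem_of_polarization hz
    have hvv : v ∈ P → v * v ∈ P := fun h => P.mul_mem_left _ h
    by_cases hvP : v ∈ P
    · exact .inr (hvv hvP)
    · left
      refine (hprime (u * u) v fun d => ?_).resolve_right hvP
      refine (hprime v _ fun c => ?_).resolve_left hvP
      have := hpol (star c) d
      rw [star_star] at this
      simpa only [mul_assoc] using this
  obtain ⟨χ, hχP⟩ := exists_character_of_scalar_mod hP hP1 fun x hx =>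
    exists_real_sub_algebraMap_mem hcl hP1 hx fun t => by
      have key : ∀ f g : ℝ → ℝ, Continuous f → Continuous g → (∀ s, f s * g s = 0) →
          (∀ s, 0 ≤ f s) → (∀ s, 0 ≤ g s) → cfc f x ∈ P ∨ cfc g x ∈ P := by
        intro f g hf hg hfg hf0 hg0
        have hm : ∀ {p q : ℝ → ℝ}, Continuous p → Continuous q → (∀ s, p s * q s = 0) →
            cfc p x * cfc q x = 0 := fun {p q} hp hq hpq => by
          rw [← cfc_mul _ _ x hp.continuousOn hq.continuousOn, ← cfc_zero ℝ x]
          congr 1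
          funext s
          exact hpq s
        have hs : ∀ p : ℝ → ℝ, Continuous p → (∀ s, 0 ≤ p s) →
            cfc (fun s => √(p s)) x * cfc (fun s => √(p s)) x = cfc p x := fun p hp hp0 => by
          rw [← cfc_mul _ _ x (by fun_prop) (by fun_prop)]
          congr 1
          funext s
          exact Real.mul_self_sqrt (hp0 s)
        rw [← hs f hf hf0, ← hs g hg hg0]
        refine hpair _ _ (cfc_predicate _ x) (cfc_predicate _ x)
          (hm (by fun_prop) (by fun_prop) fun s => ?_) (hm (by fun_prop) (by fun_prop) fun s => ?_)
        · rw [← Real.sqrt_mul (hf0 s), hfg, Real.sqrt_zero]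
        · rw [← Real.sqrt_mul (hg0 s), mul_comm, hfg, Real.sqrt_zero]
      refine key _ _ (by fun_prop) (by fun_prop) (fun s => ?_) (fun s => le_max_right _ _)
        (fun s => le_max_right _ _)
      rcases le_total s t with h | h
      · rw [max_eq_right (by linarith), zero_mul]
      · rw [max_eq_right (by linarith : -(s - t) ≤ 0), mul_zero]
  refine hPnot (ε / 2) (by linarith) (by linarith) (hχP _ ?_)
  have := hχ ((χ : R →⋆ₙₐ[ℂ] ℂ).comp (Unitization.inrNonUnitalStarAlgHom ℂ B))
    (cfcₙ (fun t : ℝ => max (t - ε / 2) 0) a)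
  rw [cutDown, ← Unitization.real_cfcₙ_eq_cfc_inr a (fun t : ℝ => max (t - ε / 2) 0)
      (by simp; positivity)]
  exact this

end

section StarHom

variable {A B : Type*} [NonUnitalCStarAlgebra A] [NonUnitalCStarAlgebra B]

theorem continuous_nonUnitalStarAlgHom (φ : A →⋆ₙₐ[ℂ] B) : Continuous φ :=
  AddMonoidHomClass.continuous_of_bound φ 1 fun x => by
    simpa using NonUnitalStarAlgHom.norm_apply_le φ x

theorem exists_norm_le_map_eq_of_isSelfAdjoint (φ : A →⋆ₙₐ[ℂ] B) {x : A}
    (hx : IsSelfAdjoint x) : ∃ x' : A, φ x' = φ x ∧ ‖x'‖ ≤ ‖φ x‖ := by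
  have hφ := continuous_nonUnitalStarAlgHom φ
  have h0 : max (-‖φ x‖) (min 0 ‖φ x‖) = 0 := by
    rw [min_eq_left (norm_nonneg _), max_eq_right (by simp)]
  refine ⟨cfcₙ (fun t : ℝ => max (-‖φ x‖) (min t ‖φ x‖)) x, ?_, ?_⟩
  · have hφx : IsSelfAdjoint (φ x) := hx.map φ
    rw [NonUnitalStarAlgHom.map_cfcₙ φ _ x (by fun_prop) h0 hφ hx hφx]
    conv_rhs => rw [← cfcₙ_id' ℝ (φ x)]
    refine cfcₙ_congr fun t ht => ?_
    have : ‖t‖ ≤ ‖φ x‖ :=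
      NonUnitalIsometricContinuousFunctionalCalculus.norm_quasispectrum_le _ ht
    rw [Real.norm_eq_abs, abs_le] at this
    rw [min_eq_left this.2, max_eq_right this.1]
  · refine norm_cfcₙ_le fun t _ => ?_
    rw [Real.norm_eq_abs, abs_le]
    have := norm_nonneg (φ x)
    exact ⟨le_max_left _ _, max_le (by linarith) (min_le_right _ _)⟩

theorem exists_norm_le_map_eq (φ : A →⋆ₙₐ[ℂ] B) (x : A) :
    ∃ x' : A, φ x' = φ x ∧ ‖x'‖ ≤ 2 * ‖φ x‖ := by
  obtain ⟨h, hh, hn⟩ := exists_norm_le_map_eq_of_isSelfAdjoint φ (realPart x).2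
  obtain ⟨k, hk, kn⟩ := exists_norm_le_map_eq_of_isSelfAdjoint φ (imaginaryPart x).2
  have hs : ‖star (φ x)‖ = ‖φ x‖ := norm_star _
  have e1 : φ (realPart x : A) = (2⁻¹ : ℂ) • (φ x + star (φ x)) := by
    rw [realPart_apply_coe, ← map_star, ← map_add, ← map_smul]
    congr 1
    rw [← Complex.coe_smul]; norm_num
  have e2 : φ (imaginaryPart x : A) = (-Complex.I * 2⁻¹ : ℂ) • (φ x - star (φ x)) := by
    rw [imaginaryPart_apply_coe, ← map_star, ← map_sub, ← map_smul]
    congr 1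
    rw [mul_smul, ← Complex.coe_smul]; norm_num
  have n1 : ‖φ (realPart x : A)‖ ≤ ‖φ x‖ := by
    rw [e1, norm_smul]
    have := norm_add_le (φ x) (star (φ x))
    rw [hs] at this
    norm_num
    linarith
  have n2 : ‖φ (imaginaryPart x : A)‖ ≤ ‖φ x‖ := by
    rw [e2, norm_smul]
    have := norm_sub_le (φ x) (star (φ x))
    rw [hs] at this
    simp only [neg_mul, norm_neg, norm_mul, Complex.norm_I, one_mul]
    norm_num
    linarith
  refine ⟨h + Complex.I • k, ?_, ?_⟩
  · rw [map_add, map_smul, hh, hk, ← map_smul, ← map_add, realPart_add_I_smul_imaginaryPart]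
  · calc ‖h + Complex.I • k‖ ≤ ‖h‖ + ‖Complex.I • k‖ := norm_add_le _ _
      _ = ‖h‖ + ‖k‖ := by rw [norm_smul, Complex.norm_I, one_mul]
      _ ≤ 2 * ‖φ x‖ := by linarith

/-- The range of a `*`-homomorphism between C*-algebras is closed. -/
theorem isClosed_range_nonUnitalStarAlgHom (φ : A →⋆ₙₐ[ℂ] B) : IsClosed (Set.range φ) := by
  let f : NormedAddGroupHom A B :=
    { toFun := φ
      map_add' := map_add φ
      bound' := ⟨1, fun x => by simpa using NonUnitalStarAlgHom.norm_apply_le φ x⟩ }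
  have hsurj : f.SurjectiveOnWith f.range 2 := by
    rintro _ ⟨x, rfl⟩
    exact exists_norm_le_map_eq φ x
  have := controlled_closure_of_complete two_pos one_pos hsurj
  refine isClosed_of_closure_subset fun y hy => ?_
  obtain ⟨x, hx, -⟩ := this y hy
  exact ⟨x, hx⟩

end StarHom

section Compact

variable {H : Type*} [NormedAddCommGroup H] [InnerProductSpace ℂ H] [CompleteSpace H]

/-- A closed additive subgroup of operators containing the rank one operators contains all
compact operators. -/
theorem IsCompactOperator.mem_of_rankOne_mem {K : AddSubgroup (H →L[ℂ] H)}
    (hK : IsClosed (K : Set (H →L[ℂ] H))) (h : ∀ x y : H, InnerProductSpace.rankOne ℂ x y ∈ K)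
    {T : H →L[ℂ] H} (hT : IsCompactOperator T) : T ∈ K := by
  rw [← SetLike.mem_coe, ← hK.closure_eq]
  refine Metric.mem_closure_iff.2 fun ε hε => ?_
  have hcomp := hT.isCompact_closure_image_closedBall (f := (T : H →ₗ[ℂ] H)) 1
  obtain ⟨t, ht, hcov⟩ := Metric.totallyBounded_iff.1
    (hcomp.totallyBounded.subset subset_closure) (ε / 2) (half_pos hε)
  let U := Submodule.span ℂ t
  have : FiniteDimensional ℂ U := FiniteDimensional.span_of_finite ℂ ht
  have hmem : U.starProjection ∘L T ∈ K := by
    rw [(stdOrthonormalBasis ℂ U).starProjection_eq_sum_rankOne, ContinuousLinearMap.finsetSum_comp]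
    refine sum_mem fun i _ => ?_
    rw [InnerProductSpace.rankOne_comp]
    exact h _ _
  refine ⟨_, hmem, ?_⟩
  rw [dist_eq_norm]
  refine (ContinuousLinearMap.opNorm_le_of_unit_norm (half_pos hε).le fun x hx => ?_).trans_lt
    (half_lt_self hε)
  obtain ⟨y, hy, hxy⟩ := Set.mem_iUnion₂.1 (hcov ⟨x, by simp [hx], rfl⟩)
  rw [sub_apply, ContinuousLinearMap.comp_apply,
    Submodule.starProjection_minimal]
  refine (ciInf_le ⟨0, by rintro _ ⟨z, rfl⟩; positivity⟩
    (⟨y, Submodule.subset_span hy⟩ : U)).trans ?_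
  rw [Metric.mem_ball, dist_eq_norm] at hxy
  exact hxy.le

end Compact

section Corner

variable {A : Type*} [NonUnitalCStarAlgebra A]

open scoped ComplexOrder

/-- An element of a closed subalgebra `B` which is positive in `A` is positive in `B`. -/
theorem exists_mul_self_eq_of_nonneg [PartialOrder A] [StarOrderedRing A]
    {B : NonUnitalStarSubalgebra ℂ A} [IsClosed (B : Set A)] {t : B} (ht : 0 ≤ (t : A)) :
    ∃ q : B, IsSelfAdjoint q ∧ q * q = t := by
  have hts : IsSelfAdjoint t := Subtype.ext (IsSelfAdjoint.of_nonneg ht).star_eq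
  refine ⟨cfcₙ (fun s : ℝ => √s) t, cfcₙ_predicate _ t, ?_⟩
  apply Subtype.ext
  have hi : (cfcₙ (fun s : ℝ => √s) t : B) = cfcₙ (fun s : ℝ => √s) (t : A) :=
    NonUnitalStarAlgHom.map_cfcₙ (NonUnitalStarSubalgebraClass.subtype B) (fun s : ℝ => √s) t
      (by fun_prop) (by simp) continuous_subtype_val hts (IsSelfAdjoint.of_nonneg ht)
  rw [NonUnitalStarSubalgebra.coe_mul, hi,
    ← cfcₙ_mul _ _ _ (by fun_prop) (by simp) (by fun_prop) (by simp)]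
  conv_rhs => rw [← cfcₙ_id' ℝ (t : A)]
  exact cfcₙ_congr fun s hs => Real.mul_self_sqrt (quasispectrum_nonneg_of_nonneg _ ht s hs)

variable [PartialOrder A] [StarOrderedRing A] {B : NonUnitalStarSubalgebra ℂ A}
  [IsClosed (B : Set A)]

/-- The positive functional `x ↦ χ (e x e)` on `A` induced by a character `χ` of a hereditary
subalgebra. -/
noncomputable def cornerFunctional (hB : ∀ b ∈ B, ∀ c ∈ B, ∀ x : A, b * x * c ∈ B)
    (χ : B →⋆ₙₐ[ℂ] ℂ) (e : B) (he : IsSelfAdjoint e) : A →ₚ[ℂ] ℂ :=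
  PositiveLinearMap.mk₀
    { toFun := fun x => χ ⟨e * x * e, hB _ e.2 _ e.2 x⟩
      map_add' := fun x y => by
        rw [← map_add]
        congr 1
        exact Subtype.ext (by simp [mul_add, add_mul])
      map_smul' := fun c x => by
        rw [RingHom.id_apply, ← map_smul]
        congr 1
        exact Subtype.ext (by simp [mul_smul_comm, smul_mul_assoc]) }
    fun x hx => by
      have hes : star (e : A) = e := congrArg Subtype.val he.star_eq
      have hpos : 0 ≤ (e : A) * x * e := by
        simpa [hes] using star_left_conjugate_nonneg hx (e : A)
      obtain ⟨q, hq, hqq⟩ := exists_mul_self_eq_of_nonneg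
        (t := (⟨e * x * e, hB _ e.2 _ e.2 x⟩ : B)) hpos
      change 0 ≤ χ _
      rw [← hqq, map_mul]
      have : star (χ q) = χ q := by rw [← map_star, hq.star_eq]
      nth_rewrite 1 [← this]
      exact star_mul_self_nonneg _

theorem cornerFunctional_apply (hB : ∀ b ∈ B, ∀ c ∈ B, ∀ x : A, b * x * c ∈ B)
    (χ : B →⋆ₙₐ[ℂ] ℂ) (e : B) (he : IsSelfAdjoint e) (x : A) :
    cornerFunctional hB χ e he x = χ ⟨e * x * e, hB _ e.2 _ e.2 x⟩ := rfl

theorem gns_cornerFunctional_eq_rankOne (hB : ∀ b ∈ B, ∀ c ∈ B, ∀ x : A, b * x * c ∈ B)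
    (χ : B →⋆ₙₐ[ℂ] ℂ) (e : B) (he : IsSelfAdjoint e) (y z : A) :
    (cornerFunctional hB χ e he).gnsNonUnitalStarAlgHom (y * e * e * star z) =
      InnerProductSpace.rankOne ℂ
        (((cornerFunctional hB χ e he).toPreGNS y : (cornerFunctional hB χ e he).GNS))
        (((cornerFunctional hB χ e he).toPreGNS z : (cornerFunctional hB χ e he).GNS)) := by
  have hes : star (e : A) = e := congrArg Subtype.val he.star_eq
  set f := cornerFunctional hB χ e he with hf
  ext c
  induction c using UniformSpace.Completion.induction_on with
  | hp => apply isClosed_eq <;> fun_prop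
  | ih c =>
    set w := f.ofPreGNS c with hw
    rw [f.gnsNonUnitalStarAlgHom_apply_coe, InnerProductSpace.rankOne_apply,
      UniformSpace.Completion.inner_coe, f.preGNS_inner_def, ← UniformSpace.Completion.coe_smul,
      ← sub_eq_zero, ← UniformSpace.Completion.coe_sub, ← norm_eq_zero,
      UniformSpace.Completion.norm_coe, ← sq_eq_zero_iff, ← Complex.ofReal_eq_zero,
      Complex.ofReal_pow, f.preGNS_norm_sq]
    rw [f.ofPreGNS_toPreGNS, ← hw]
    set s : B := ⟨e * (star z * w) * e, hB _ e.2 _ e.2 _⟩ with hs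
    set t : B := ⟨e * (star y * y) * e, hB _ e.2 _ e.2 _⟩ with ht
    have hval : f (star z * w) = χ s := rfl
    rw [hval]
    have hdiff : f.ofPreGNS (f.leftMulMapPreGNS (y * e * e * star z) c - χ s • f.toPreGNS y) =
        y * e * e * star z * w - χ s • y := by
      simp [hw, mul_assoc]
    rw [hdiff, hf, cornerFunctional_apply]
    have key : (⟨e * (star (y * e * e * star z * w - χ s • y) *
        (y * e * e * star z * w - χ s • y)) * e, hB _ e.2 _ e.2 _⟩ : B) =
        star s * t * s - χ s • (star s * t) - star (χ s) • (t * s) +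
          (χ s * star (χ s)) • t := by
      generalize χ s = l
      apply Subtype.ext
      simp only [hs, ht, star_sub, star_mul, star_smul, hes, star_star, mul_sub, sub_mul,
        mul_smul_comm, smul_mul_assoc, smul_smul, NonUnitalStarSubalgebra.coe_sub,
        NonUnitalStarSubalgebra.coe_add, NonUnitalStarSubalgebra.coe_mul,
        NonUnitalStarSubalgebra.coe_smul, StarMemClass.coe_star, mul_assoc, smul_sub]
      abel
    rw [key]
    simp only [map_add, map_sub, map_mul, map_smul, map_star, smul_eq_mul]
    ring

end Corner

theorem continuous_rankOne_left {H : Type*} [NormedAddCommGroup H] [InnerProductSpace ℂ H]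
    (y : H) : Continuous fun x : H => (InnerProductSpace.rankOne ℂ x y : H →L[ℂ] H) :=
  continuous_of_linear_of_bound (𝕜 := ℂ) (C := ‖y‖) (fun a b => by rw [map_add]; rfl)
    (fun c a => by rw [map_smul]; rfl)
    (fun x => by rw [InnerProductSpace.norm_rankOne, mul_comm])

theorem rankOne_mem_of_denseRange {H : Type*} [NormedAddCommGroup H] [InnerProductSpace ℂ H]
    {K : Set (H →L[ℂ] H)} (hK : IsClosed K) {ι : Type*} {g : ι → H} (hg : DenseRange g)
    (h : ∀ i j, InnerProductSpace.rankOne ℂ (g i) (g j) ∈ K) (x y : H) :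
    InnerProductSpace.rankOne ℂ x y ∈ K := by
  refine hg.induction_on x (hK.preimage (continuous_rankOne_left y)) fun i => ?_
  exact hg.induction_on y (hK.preimage (InnerProductSpace.rankOne ℂ (g i)).continuous)
    fun j => h i j

theorem isCompactOperator_rankOne {H : Type*} [NormedAddCommGroup H] [InnerProductSpace ℂ H]
    (x y : H) : IsCompactOperator (InnerProductSpace.rankOne ℂ x y : H →L[ℂ] H) := by
  rw [InnerProductSpace.rankOne_def']
  exact (isCompactOperator_of_locallyCompactSpace_rng
    (ContinuousLinearMap.toSpanSingleton ℂ x)).comp_clm _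

/-- A character on a closed hereditary subalgebra produces an elementary ideal-quotient. -/
theorem hasNonzeroElementaryIdealQuotient_of_character {A : Type} [NonUnitalCStarAlgebra A]
    {B : NonUnitalStarSubalgebra ℂ A} [IsClosed (B : Set A)]
    (hB : ∀ b ∈ B, ∀ c ∈ B, ∀ x : A, b * x * c ∈ B) (χ : B →⋆ₙₐ[ℂ] ℂ) {b : B} (hb : χ b ≠ 0) :
    HasNonzeroElementaryIdealQuotient A := by
  let _ := CStarAlgebra.spectralOrder A
  have _ := CStarAlgebra.spectralOrderedRing A
  obtain ⟨e, he, hχe⟩ : ∃ e : B, IsSelfAdjoint e ∧ χ e ≠ 0 := by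
    refine ⟨star b * b, IsSelfAdjoint.star_mul_self b, ?_⟩
    rw [map_mul, map_star]
    exact mul_ne_zero (star_ne_zero.2 hb) hb
  set f := cornerFunctional hB χ e he with hf
  set π := f.gnsNonUnitalStarAlgHom with hπ
  have hrank := gns_cornerFunctional_eq_rankOne hB χ e he
  rw [← hf, ← hπ] at hrank
  have hπc : Continuous π := continuous_nonUnitalStarAlgHom π
  let J : ClosedTwoSidedIdealC A :=
    { carrier :=
        { carrier := {x | IsCompactOperator (π x) ∧ IsCompactOperator (π (star x))}
          add_mem' := fun {x y} hx hy => by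
            simp only [Set.mem_ofPred_eq, star_add, map_add] at hx hy ⊢
            exact ⟨hx.1.add hy.1, hx.2.add hy.2⟩
          zero_mem' := by
            simp only [Set.mem_ofPred_eq, star_zero, map_zero]
            exact ⟨isCompactOperator_zero, isCompactOperator_zero⟩
          mul_mem' := fun {x y} hx hy => by
            simp only [Set.mem_ofPred_eq, star_mul, map_mul] at hx hy ⊢
            exact ⟨hx.1.comp_clm (π y), hx.2.clm_comp (π (star y))⟩
          smul_mem' := fun c x hx => by
            simp only [Set.mem_ofPred_eq, star_smul, map_smul] at hx ⊢
            exact ⟨hx.1.smul c, hx.2.smul (star c)⟩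
          star_mem' := fun {x} hx => by
            simp only [Set.mem_ofPred_eq, star_star] at hx ⊢
            exact ⟨hx.2, hx.1⟩ }
      isClosed := (isClosed_setOfPred_isCompactOperator.preimage hπc).inter
        (isClosed_setOfPred_isCompactOperator.preimage (hπc.comp continuous_star))
      mul_mem_left := fun a x hx => by
        change IsCompactOperator (π (a * x)) ∧ IsCompactOperator (π (star (a * x)))
        rw [star_mul, map_mul, map_mul]
        exact ⟨hx.1.clm_comp (π a), hx.2.comp_clm (π (star a))⟩
      mul_mem_right := fun a x hx => by
        change IsCompactOperator (π (x * a)) ∧ IsCompactOperator (π (star (x * a)))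
        rw [star_mul, map_mul, map_mul]
        exact ⟨hx.1.comp_clm (π a), hx.2.clm_comp (π (star a))⟩ }
  have : IsClosed (J.carrier : Set A) := J.isClosed
  let ψ : J.carrier →⋆ₙₐ[ℂ] (f.GNS →L[ℂ] f.GNS) :=
    π.comp (NonUnitalStarSubalgebraClass.subtype J.carrier)
  have hψ : ∀ x : J.carrier, ψ x = π x := fun x => rfl
  have hJ : ∀ y z : A, y * e * e * star z ∈ J.carrier := by
    intro y z
    have h2 : star (y * e * e * star z) = z * e * e * star y := by
      have hes : star (e : A) = e := congrArg Subtype.val he.star_eq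
      simp [hes, mul_assoc]
    refine ⟨?_, ?_⟩
    · rw [hrank]; exact isCompactOperator_rankOne _ _
    · rw [h2, hrank]; exact isCompactOperator_rankOne _ _
  have hcl : IsClosed (Set.range ψ) := isClosed_range_nonUnitalStarAlgHom ψ
  refine ⟨J, f.GNS, inferInstance, inferInstance, inferInstance, ψ, ?_, ?_⟩
  · apply Set.Subset.antisymm
    · rintro _ ⟨x, rfl⟩
      exact x.2.1
    · intro T hT
      let K : AddSubgroup (f.GNS →L[ℂ] f.GNS) := (ψ : J.carrier →+ (f.GNS →L[ℂ] f.GNS)).range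
      have hKcl : IsClosed (K : Set (f.GNS →L[ℂ] f.GNS)) := hcl
      refine IsCompactOperator.mem_of_rankOne_mem (K := K) hKcl (fun x y => ?_) hT
      refine rankOne_mem_of_denseRange hKcl UniformSpace.Completion.denseRange_coe
        (fun x y => ?_) x y
      exact ⟨⟨_, hJ (f.ofPreGNS x) (f.ofPreGNS y)⟩, hrank (f.ofPreGNS x) (f.ofPreGNS y)⟩
  · refine ⟨⟨_, hJ e e⟩, fun h0 => ?_⟩
    rw [hψ, hrank, InnerProductSpace.rankOne_eq_zero, or_self, ← norm_eq_zero,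
      UniformSpace.Completion.norm_coe, ← sq_eq_zero_iff, ← Complex.ofReal_eq_zero,
      Complex.ofReal_pow, f.preGNS_norm_sq, f.ofPreGNS_toPreGNS] at h0
    have hval : f (star (e : A) * e) = χ (e * (star e * e) * e) := rfl
    rw [hval, map_mul, map_mul, map_mul, map_star] at h0
    exact mul_ne_zero (mul_ne_zero hχe (mul_ne_zero (star_ne_zero.2 hχe) hχe)) hχe h0

section Cuntz

variable {B : Type*} [NonUnitalCStarAlgebra B]

theorem cuntzBelow_iff_mem_closure {a b : B} :
    CuntzBelow a b ↔ a ∈ closure (Set.range fun r : B => r * b * star r) := by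
  rw [mem_closure_iff_seq_limit]
  constructor
  · rintro ⟨r, hr⟩
    exact ⟨_, fun n => ⟨r n, rfl⟩, hr⟩
  · rintro ⟨u, hu, hlim⟩
    choose r hr using hu
    exact ⟨r, by simpa only [hr] using hlim⟩

theorem cuntzBelow_conjugate (r b : B) : CuntzBelow (r * b * star r) b :=
  ⟨fun _ => r, tendsto_const_nhds⟩

theorem mul_mem_closure_range_mul_right (x : B) {y w : B}
    (hy : y ∈ closure (Set.range fun r : B => r * w)) :
    x * y ∈ closure (Set.range fun r : B => r * w) :=
  map_mem_closure (continuous_const_mul x) hy fun _ ⟨r, hr⟩ => ⟨x * r, by simp [← hr, mul_assoc]⟩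

theorem add_mem_closure_range_mul_right {x y w : B}
    (hx : x ∈ closure (Set.range fun r : B => r * w))
    (hy : y ∈ closure (Set.range fun r : B => r * w)) :
    x + y ∈ closure (Set.range fun r : B => r * w) :=
  map_mem_closure₂ continuous_add hx hy
    fun _ ⟨r, hr⟩ _ ⟨s, hs⟩ => ⟨r + s, by simp [← hr, ← hs, add_mul]⟩

theorem mul_eq_zero_of_mul_self_mul_mul_self_eq_zero {x y : B}
    (hx : IsSelfAdjoint x) (hy : IsSelfAdjoint y) (h : x * x * (y * y) = 0) : x * y = 0 := by
  have h1 : x * (y * y) = 0 := by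
    rw [← CStarRing.star_mul_self_eq_zero_iff, star_mul, star_mul, hx.star_eq, hy.star_eq,
      mul_assoc, ← mul_assoc x, h, mul_zero]
  rw [← CStarRing.mul_star_self_eq_zero_iff, star_mul, hx.star_eq, hy.star_eq,
    ← mul_assoc, mul_assoc x, h1, zero_mul]

variable [PartialOrder B] [StarOrderedRing B]

theorem cStarNonneg_iff_nonneg {a : B} : CStarNonneg a ↔ 0 ≤ a :=
  CStarAlgebra.nonneg_iff_eq_star_mul_self.symm

theorem exists_isSelfAdjoint_mul_self_eq {w : B} (hw : 0 ≤ w) :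
    ∃ h : B, IsSelfAdjoint h ∧ h * h = w :=
  ⟨CFC.sqrt w, (CFC.sqrt_nonneg w).isSelfAdjoint, CFC.sqrt_mul_sqrt_self w hw⟩

theorem cuntzBelow_mul_star_of_mem_closure {w s : B} (hw : 0 ≤ w)
    (hs : s ∈ closure (Set.range fun r : B => r * w)) : CuntzBelow (s * star s) w := by
  obtain ⟨h, hh, rfl⟩ := exists_isSelfAdjoint_mul_self_eq hw
  rw [cuntzBelow_iff_mem_closure]
  refine map_mem_closure (f := fun s => s * star s) (by fun_prop) hs ?_
  rintro _ ⟨x, rfl⟩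
  refine ⟨x * h, ?_⟩
  simp [hh.star_eq, mul_assoc]

theorem mem_closure_range_mul_right_of_star_mul_self_le {y w : B} (h : star y * y ≤ w) :
    y ∈ closure (Set.range fun r : B => r * w) := by
  have hw : 0 ≤ w := (star_mul_self_nonneg y).trans h
  rw [Metric.mem_closure_iff]
  intro η hη
  obtain ⟨δ, hδ, hδη⟩ : ∃ δ : ℝ, 0 < δ ∧ √δ < η ^ 2 :=
    ⟨(η ^ 2 / 2) ^ 2, by positivity, by
      rw [Real.sqrt_sq (by positivity)]; linarith [pow_pos hη 2]⟩
  have hne : ∀ t : ℝ, t ^ 2 + δ ≠ 0 := fun t => by positivity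
  have hws : IsSelfAdjoint w := IsSelfAdjoint.of_nonneg hw
  have hcont : Continuous fun t : ℝ => t / (t ^ 2 + δ) := by fun_prop (disch := exact hne _)
  set c := cfcₙ (fun t : ℝ => t / (t ^ 2 + δ)) w with hc
  set F : ℝ → ℝ := fun t => t / (t ^ 2 + δ) * t with hF
  have hFc : Continuous F := by fun_prop
  have hF0 : F 0 = 0 := by simp [hF]
  have hid : cfcₙ (fun t : ℝ => t) w = w := cfcₙ_id' ℝ w
  set p := c * w with hp
  have hpF : p = cfcₙ F w := by
    rw [hF, cfcₙ_mul _ _ w hcont.continuousOn (by simp) (by fun_prop) (by simp), hid]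
  have hps : star p = p := by rw [hpF]; exact cfcₙ_predicate (R := ℝ) F w
  refine ⟨y * p, ⟨y * c, mul_assoc _ _ _⟩, ?_⟩
  have hexp : ∀ g : B, star (g - g * p) * (g - g * p) =
      star g * g - star g * g * p - p * (star g * g) + p * (star g * g) * p := fun g => by
    simp only [star_sub, star_mul, hps, sub_mul, mul_sub, mul_assoc]
    abel
  have hle : star (y - y * p) * (y - y * p) ≤ w - w * p - p * w + p * w * p := by
    obtain ⟨g, hg⟩ := CStarAlgebra.nonneg_iff_eq_star_mul_self.1 (sub_nonneg.2 h)
    obtain rfl : w = star g * g + star y * y := by rw [← hg]; abel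
    have h1 := star_mul_self_nonneg (g - g * p)
    rw [← sub_nonneg]
    rw [hexp] at h1 ⊢
    convert h1 using 1
    simp only [mul_add, add_mul]
    abel
  have hG : ∀ F : ℝ → ℝ, Continuous F → F 0 = 0 →
      w - w * cfcₙ F w - cfcₙ F w * w + cfcₙ F w * w * cfcₙ F w =
        cfcₙ (fun t : ℝ => t - t * F t - F t * t + F t * t * F t) w := fun F hFc hF0 => by
    rw [cfcₙ_add _ _ w (by fun_prop) (by simp) (by fun_prop) (by simp [hF0]),
      cfcₙ_sub _ _ w (by fun_prop) (by simp) (by fun_prop) (by simp),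
      cfcₙ_sub _ _ w (by fun_prop) (by simp) (by fun_prop) (by simp),
      cfcₙ_mul _ F w (by fun_prop) (by simp) (by fun_prop) hF0,
      cfcₙ_mul _ F w (by fun_prop) (by simp) (by fun_prop) hF0,
      cfcₙ_mul F _ w (by fun_prop) hF0 (by fun_prop) (by simp), hid]
  have hnorm : ‖w - w * p - p * w + p * w * p‖ ≤ √δ := by
    rw [hpF, hG F hFc hF0]
    refine norm_cfcₙ_le fun t ht => ?_
    have ht0 : 0 ≤ t := quasispectrum_nonneg_of_nonneg _ hw t ht
    have : t - t * F t - F t * t + F t * t * F t = t * δ ^ 2 / (t ^ 2 + δ) ^ 2 := by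
      simp only [hF]
      have := hne t
      field_simp
      ring
    rw [this, Real.norm_of_nonneg (by positivity), div_le_iff₀ (by positivity)]
    have hs := Real.sq_sqrt hδ.le
    set s := √δ
    have hs0 : 0 ≤ s := Real.sqrt_nonneg δ
    rw [← hs]
    nlinarith [mul_nonneg hs0 (sq_nonneg (t ^ 2)),
      mul_nonneg (pow_nonneg hs0 3) (sq_nonneg (t - s)),
      mul_nonneg (pow_nonneg hs0 3) (sq_nonneg t), pow_nonneg hs0 5]
  have hsq : ‖y - y * p‖ * ‖y - y * p‖ < η ^ 2 := by
    rw [← CStarRing.norm_star_mul_self]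
    exact ((CStarAlgebra.norm_le_norm_of_nonneg_of_le (star_mul_self_nonneg _) hle).trans
      hnorm).trans_lt hδη
  rw [dist_eq_norm]
  exact lt_of_pow_lt_pow_left₀ 2 hη.le (by rwa [sq])

theorem cuntzBelow_mul_star_of_star_mul_self_le {y w : B} (h : star y * y ≤ w) :
    CuntzBelow (y * star y) w :=
  cuntzBelow_mul_star_of_mem_closure ((star_mul_self_nonneg y).trans h)
    (mem_closure_range_mul_right_of_star_mul_self_le h)

theorem cuntzBelow_of_le {y w : B} (hy : 0 ≤ y) (h : y ≤ w) : CuntzBelow y w := by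
  obtain ⟨s, hs, rfl⟩ := exists_isSelfAdjoint_mul_self_eq hy
  have := cuntzBelow_mul_star_of_star_mul_self_le (y := s) (w := w) (by rwa [hs.star_eq])
  rwa [hs.star_eq] at this

theorem mem_closure_range_mul_right_self {a : B} (ha : 0 ≤ a) :
    a ∈ closure (Set.range fun r : B => r * a) := by
  obtain ⟨s, hs, hsa⟩ := exists_isSelfAdjoint_mul_self_eq ha
  have := mul_mem_closure_range_mul_right s
    (mem_closure_range_mul_right_of_star_mul_self_le (w := a) (by rw [hs.star_eq, hsa]))
  rwa [hsa] at this

theorem cuntzBelow_add_of_orthogonal {w₁ w₂ v₁ v₂ : B} (hv₁ : 0 ≤ v₁) (hv₂ : 0 ≤ v₂)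
    (h₁ : CuntzBelow w₁ v₁) (h₂ : CuntzBelow w₂ v₂) (hv : v₁ * v₂ = 0) :
    CuntzBelow (w₁ + w₂) (v₁ + v₂) := by
  rw [cuntzBelow_iff_mem_closure] at h₁ h₂ ⊢
  rw [← closure_closure]
  refine map_mem_closure₂ continuous_add h₁ h₂ ?_
  rintro _ ⟨r, rfl⟩ _ ⟨s, rfl⟩
  rw [← cuntzBelow_iff_mem_closure]
  obtain ⟨x, hx, rfl⟩ := exists_isSelfAdjoint_mul_self_eq hv₁
  obtain ⟨y, hy, rfl⟩ := exists_isSelfAdjoint_mul_self_eq hv₂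
  have hxy : x * y = 0 := mul_eq_zero_of_mul_self_mul_mul_self_eq_zero hx hy hv
  have hyx : y * x = 0 := by simpa [hx.star_eq, hy.star_eq] using congrArg star hxy
  have hT : r * x + s * y ∈ closure (Set.range fun t : B => t * (x * x + y * y)) := by
    refine add_mem_closure_range_mul_right (mul_mem_closure_range_mul_right _ ?_)
      (mul_mem_closure_range_mul_right _ ?_)
    · exact mem_closure_range_mul_right_of_star_mul_self_le
        (by rw [hx.star_eq]; exact le_add_of_nonneg_right hv₂)
    · exact mem_closure_range_mul_right_of_star_mul_self_le
        (by rw [hy.star_eq]; exact le_add_of_nonneg_left hv₁)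
  have := cuntzBelow_mul_star_of_mem_closure (add_nonneg hv₁ hv₂) hT
  convert this using 1
  simp only [star_add, star_mul, hx.star_eq, hy.star_eq, mul_add, add_mul]
  have e1 : r * x * (y * star s) = 0 := by rw [mul_assoc, ← mul_assoc x, hxy, zero_mul, mul_zero]
  have e2 : s * y * (x * star r) = 0 := by rw [mul_assoc, ← mul_assoc y, hyx, zero_mul, mul_zero]
  rw [e1, e2]
  simp [mul_assoc]

/-- If `w` is close to `a`, then a cut-down of `a` is dominated by a conjugate of `w`. -/
theorem exists_cutDown_le_conjugate {a w : B} (ha : IsSelfAdjoint a) (hw : IsSelfAdjoint w) {ε : ℝ}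
    (h : ‖a - w‖ < ε) :
    ∃ f : B, cfcₙ (fun t : ℝ => max (t - ε) 0) a ≤ f * w * star f := by
  set η := ‖a - w‖ with hη
  have hε : 0 < ε := (norm_nonneg _).trans_lt h
  set g : ℝ → ℝ := fun t => √(max (t - ε) 0 / max (t - η) (ε - η)) with hg
  have hne : ∀ t : ℝ, max (t - η) (ε - η) ≠ 0 := fun t =>
    (lt_of_lt_of_le (sub_pos.2 h) (le_max_right _ _)).ne'
  have hgc : Continuous g := by fun_prop (disch := exact hne _)
  have hg0 : g 0 = 0 := by simp [hg, hε.le]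
  refine ⟨cfcₙ g a, ?_⟩
  have hs : star (cfcₙ g a) = cfcₙ g a := cfcₙ_predicate (R := ℝ) g a
  have hle := CStarAlgebra.star_left_conjugate_le_norm_smul (a := cfcₙ g a) (b := a - w) (ha.sub hw)
  rw [hs, ← hη, mul_sub, sub_mul] at hle
  rw [hs]
  have hid : cfcₙ (fun t : ℝ => t) a = a := cfcₙ_id' ℝ a
  have key : cfcₙ (fun t : ℝ => max (t - ε) 0) a =
      cfcₙ g a * a * cfcₙ g a - η • (cfcₙ g a * cfcₙ g a) := by
    conv_rhs =>
      enter [1, 1, 2]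
      rw [← hid]
    rw [← cfcₙ_mul _ _ a (by fun_prop) hg0 (by fun_prop) (by simp),
      ← cfcₙ_mul _ _ a (by fun_prop) (by simp) (by fun_prop) hg0,
      ← cfcₙ_mul _ _ a (by fun_prop) hg0 (by fun_prop) hg0,
      ← cfcₙ_smul _ _ a (by fun_prop) (by simp [hg0]),
      ← cfcₙ_sub _ _ a (by fun_prop) (by simp [hg0]) (by fun_prop) (by simp [hg0])]
    congr 1
    funext t
    have hsq : g t * g t = max (t - ε) 0 / max (t - η) (ε - η) :=
      Real.mul_self_sqrt (div_nonneg (le_max_right _ _)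
        ((sub_pos.2 h).le.trans (le_max_right _ _)))
    have : g t * t * g t - η • (g t * g t) = (g t * g t) * (t - η) := by
      rw [smul_eq_mul]; ring
    rw [this, hsq]
    rcases le_total t ε with ht | ht
    · simp [ht]
    · rw [max_eq_left (sub_le_sub_right ht η), div_mul_cancel₀]
      have := sub_pos.2 h
      linarith
  rw [key]
  exact sub_le_comm.1 hle

theorem cfcₙ_cutDown_nonneg (a : B) (ε : ℝ) : 0 ≤ cfcₙ (fun t : ℝ => max (t - ε) 0) a :=
  cfcₙ_nonneg fun _ _ => le_max_right _ _

theorem norm_sub_cfcₙ_cutDown_le {a : B} (ha : 0 ≤ a) {ε : ℝ} (hε : 0 ≤ ε) :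
    ‖a - cfcₙ (fun t : ℝ => max (t - ε) 0) a‖ ≤ ε := by
  have has : IsSelfAdjoint a := IsSelfAdjoint.of_nonneg ha
  have : a - cfcₙ (fun t : ℝ => max (t - ε) 0) a = cfcₙ (fun t : ℝ => t - max (t - ε) 0) a := by
    rw [cfcₙ_sub _ _ a (by fun_prop) (by simp) (by fun_prop) (by simp [hε]), cfcₙ_id' ℝ a]
  rw [this]
  refine norm_cfcₙ_le fun t ht => ?_
  have ht0 : 0 ≤ t := quasispectrum_nonneg_of_nonneg _ ha t ht
  rw [Real.norm_eq_abs, abs_le]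
  rcases le_total t ε with h | h
  · rw [max_eq_right (by linarith)]; constructor <;> linarith
  · rw [max_eq_left (by linarith)]; constructor <;> linarith

end Cuntz

instance CuSemigroup.isOrderedAddMonoid {S : Type*} [CuSemigroup S] : IsOrderedAddMonoid S where
  add_le_add_left a b h c := by
    simpa only [add_comm _ c] using CuSemigroup.add_le_add' a b h c

/-- The embedding of `A` as the algebra of `1 × 1` matrices. -/
def matOne (A : Type*) [NonUnitalCStarAlgebra A] : A →⋆ₙₐ[ℂ] Matrix (Fin 1) (Fin 1) A where
  toFun a := Matrix.of fun _ _ => a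
  map_smul' _ _ := rfl
  map_zero' := rfl
  map_add' _ _ := rfl
  map_mul' x y := by
    ext i j
    simp [Matrix.mul_apply]
  map_star' x := by
    ext i j
    simp [Matrix.star_apply]

namespace IsCuntzSemigroupOf

variable {A : Type*} [NonUnitalCStarAlgebra A] {S : Type*} [CuSemigroup S]
  (hS : IsCuntzSemigroupOf A S)

/-- The embedding of `A` into its stabilization. -/
noncomputable def emb : A →⋆ₙₐ[ℂ] hS.stab := (hS.matEmb 1).comp (matOne A)

theorem clsA_eq_cls_emb (a : A) : hS.clsA a = hS.cls (hS.emb a) := rfl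

theorem emb_injective : Function.Injective hS.emb := fun _ _ h =>
  congrFun (congrFun (hS.matEmb_injective 1 h) 0) 0

variable [PartialOrder hS.stab] [StarOrderedRing hS.stab]

theorem cls_le_cls {a b : hS.stab} (ha : 0 ≤ a) (hb : 0 ≤ b) (h : CuntzBelow a b) :
    hS.cls a ≤ hS.cls b :=
  (hS.cls_le_iff a b (cStarNonneg_iff_nonneg.2 ha) (cStarNonneg_iff_nonneg.2 hb)).2 h

theorem cuntzBelow_of_cls_le {a b : hS.stab} (ha : 0 ≤ a) (hb : 0 ≤ b)
    (h : hS.cls a ≤ hS.cls b) : CuntzBelow a b :=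
  (hS.cls_le_iff a b (cStarNonneg_iff_nonneg.2 ha) (cStarNonneg_iff_nonneg.2 hb)).1 h

theorem cls_mono {a b : hS.stab} (ha : 0 ≤ a) (h : a ≤ b) : hS.cls a ≤ hS.cls b :=
  hS.cls_le_cls ha (ha.trans h) (cuntzBelow_of_le ha h)

theorem cls_conjugate_le {b : hS.stab} (hb : 0 ≤ b) (r : hS.stab) :
    hS.cls (r * b * star r) ≤ hS.cls b :=
  hS.cls_le_cls (star_right_conjugate_nonneg hb r) hb (cuntzBelow_conjugate r b)

/-- Two classes are realised by orthogonal positive elements. -/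
theorem exists_nonneg_orthogonal (x y : S) : ∃ a b : hS.stab, 0 ≤ a ∧ 0 ≤ b ∧ a * b = 0 ∧
    hS.cls a = x ∧ hS.cls b = y ∧ hS.cls (a + b) = x + y := by
  obtain ⟨a, ha, rfl⟩ := hS.cls_surj x
  obtain ⟨b, hb, rfl⟩ := hS.cls_surj y
  obtain ⟨a', b', ha', hb', hab, h1, h2⟩ := hS.exists_orth a b ha hb
  refine ⟨a', b', cStarNonneg_iff_nonneg.1 ha', cStarNonneg_iff_nonneg.1 hb', hab, h1, h2, ?_⟩
  rw [hS.cls_add_orth a' b' ha' hb' hab, h1, h2]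

theorem cls_add_le {a b : hS.stab} (ha : 0 ≤ a) (hb : 0 ≤ b) :
    hS.cls (a + b) ≤ hS.cls a + hS.cls b := by
  obtain ⟨a', b', ha', hb', hab, h1, h2, h3⟩ := hS.exists_nonneg_orthogonal (hS.cls a) (hS.cls b)
  rw [← h3]
  exact hS.cls_le_cls (add_nonneg ha hb) (add_nonneg ha' hb')
    (cuntzBelow_add_of_orthogonal ha' hb' (hS.cuntzBelow_of_cls_le ha ha' h1.ge)
      (hS.cuntzBelow_of_cls_le hb hb' h2.ge) hab)

theorem wayBelow_cls_iff {x : S} {a : hS.stab} (ha : 0 ≤ a) :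
    WayBelow x (hS.cls a) ↔
      ∃ ε : ℝ, 0 < ε ∧ x ≤ hS.cls (cfcₙ (fun t : ℝ => max (t - ε) 0) a) :=
  hS.waybelow_iff x a (cStarNonneg_iff_nonneg.2 ha)

theorem exists_wayBelow_of_wayBelow_add {A : Type*} [NonUnitalCStarAlgebra A] {S : Type*}
    [CuSemigroup S] (hS : IsCuntzSemigroupOf A S) {x y z : S} (h : WayBelow x (y + z)) :
    ∃ y' z', WayBelow y' y ∧ WayBelow z' z ∧ x ≤ y' + z' := by
  let _ := CStarAlgebra.spectralOrder hS.stab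
  have _ := CStarAlgebra.spectralOrderedRing hS.stab
  obtain ⟨a, b, ha, hb, -, rfl, rfl, hab⟩ := hS.exists_nonneg_orthogonal y z
  rw [← hab, hS.wayBelow_cls_iff (add_nonneg ha hb)] at h
  obtain ⟨ε, hε, hx⟩ := h
  set a' := cfcₙ (fun t : ℝ => max (t - ε / 3) 0) a with ha'
  set b' := cfcₙ (fun t : ℝ => max (t - ε / 3) 0) b with hb'
  have ha0 : 0 ≤ a' := cfcₙ_cutDown_nonneg _ _
  have hb0 : 0 ≤ b' := cfcₙ_cutDown_nonneg _ _
  refine ⟨hS.cls a', hS.cls b', (hS.wayBelow_cls_iff ha).2 ⟨ε / 3, by positivity, le_rfl⟩,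
    (hS.wayBelow_cls_iff hb).2 ⟨ε / 3, by positivity, le_rfl⟩, hx.trans ?_⟩
  have hnorm : ‖(a + b) - (a' + b')‖ < ε := by
    have h1 := norm_sub_cfcₙ_cutDown_le ha (ε := ε / 3) (by positivity)
    have h2 := norm_sub_cfcₙ_cutDown_le hb (ε := ε / 3) (by positivity)
    rw [add_sub_add_comm]
    exact (norm_add_le _ _).trans_lt (by linarith)
  obtain ⟨f, hf⟩ := exists_cutDown_le_conjugate (add_nonneg ha hb).isSelfAdjoint
    (add_nonneg ha0 hb0).isSelfAdjoint hnorm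
  exact ((hS.cls_mono (cfcₙ_cutDown_nonneg _ _) hf).trans
    (hS.cls_conjugate_le (add_nonneg ha0 hb0) f)).trans (hS.cls_add_le ha0 hb0)

end IsCuntzSemigroupOf

/-- The hereditary subalgebra generated by `a`: the intersection of the closed left ideal generated
by `a` with its adjoint. -/
def hereditarySubalgebra {A : Type*} [NonUnitalCStarAlgebra A] (a : A) :
    NonUnitalStarSubalgebra ℂ A where
  carrier := {x | x ∈ closure (Set.range fun r : A => r * a) ∧
    star x ∈ closure (Set.range fun r : A => r * a)}
  add_mem' hx hy := by
    rw [Set.mem_ofPred_eq, star_add]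
    exact ⟨add_mem_closure_range_mul_right hx.1 hy.1, add_mem_closure_range_mul_right hx.2 hy.2⟩
  zero_mem' := by
    rw [Set.mem_ofPred_eq, star_zero, and_self]
    exact subset_closure ⟨0, zero_mul a⟩
  mul_mem' hx hy := by
    rw [Set.mem_ofPred_eq, star_mul]
    exact ⟨mul_mem_closure_range_mul_right _ hy.1, mul_mem_closure_range_mul_right _ hx.2⟩
  smul_mem' c x hx := by
    have key : ∀ (c : ℂ) {x : A}, x ∈ closure (Set.range fun r : A => r * a) →
        c • x ∈ closure (Set.range fun r : A => r * a) := fun c _ hx =>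
      map_mem_closure (continuous_const_smul c) hx
        fun _ ⟨r, hr⟩ => ⟨c • r, by simp [← hr, smul_mul_assoc]⟩
    rw [Set.mem_ofPred_eq, star_smul]
    exact ⟨key c hx.1, key _ hx.2⟩
  star_mem' hx := by
    rw [Set.mem_ofPred_eq, star_star]
    exact ⟨hx.2, hx.1⟩

theorem isClosed_hereditarySubalgebra {A : Type*} [NonUnitalCStarAlgebra A] (a : A) :
    IsClosed (hereditarySubalgebra a : Set A) :=
  isClosed_closure.inter (isClosed_closure.preimage continuous_star)

theorem mul_mul_mem_hereditarySubalgebra {A : Type*} [NonUnitalCStarAlgebra A] {a b c : A}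
    (hb : b ∈ hereditarySubalgebra a) (hc : c ∈ hereditarySubalgebra a) (x : A) :
    b * x * c ∈ hereditarySubalgebra a := by
  refine ⟨mul_mem_closure_range_mul_right _ hc.1, ?_⟩
  rw [star_mul, star_mul, ← mul_assoc]
  exact mul_mem_closure_range_mul_right _ hb.2

theorem self_mem_hereditarySubalgebra {A : Type*} [NonUnitalCStarAlgebra A] [PartialOrder A]
    [StarOrderedRing A] {a : A} (ha : 0 ≤ a) : a ∈ hereditarySubalgebra a := by
  refine ⟨mem_closure_range_mul_right_self ha, ?_⟩
  rw [(IsSelfAdjoint.of_nonneg ha).star_eq]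
  exact mem_closure_range_mul_right_self ha

/-- `y` is bounded by a finite sum of elements whose double is below `x`. -/
def IsSumOfHalves {S : Type*} [CuSemigroup S] (x y : S) : Prop :=
  ∃ L : List S, (∀ z ∈ L, 2 • z ≤ x) ∧ y ≤ L.sum

namespace IsSumOfHalves

variable {S : Type*} [CuSemigroup S] {x y z : S}

theorem zero (x : S) : IsSumOfHalves x 0 := ⟨[], by simp, le_rfl⟩

theorem of_two_nsmul_le (h : 2 • y ≤ x) : IsSumOfHalves x y := ⟨[y], by simpa using h, by simp⟩

theorem add (hy : IsSumOfHalves x y) (hz : IsSumOfHalves x z) : IsSumOfHalves x (y + z) := by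
  obtain ⟨L, hL, hy⟩ := hy
  obtain ⟨M, hM, hz⟩ := hz
  refine ⟨L ++ M, fun w hw => (List.mem_append.1 hw).elim (hL w) (hM w), ?_⟩
  rw [List.sum_append]
  exact add_le_add hy hz

theorem mono (hz : IsSumOfHalves x z) (h : y ≤ z) : IsSumOfHalves x y :=
  hz.imp fun _ hL => ⟨hL.1, h.trans hL.2⟩

end IsSumOfHalves

namespace IsCuntzSemigroupOf

theorem emb_cuntzBelow_of_mem_hereditarySubalgebra {A : Type*} [NonUnitalCStarAlgebra A]
    [PartialOrder A] [StarOrderedRing A] {S : Type*} [CuSemigroup S] (hS : IsCuntzSemigroupOf A S)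
    {a t : A} (ha : 0 ≤ a) (ht : 0 ≤ t) (hta : t ∈ hereditarySubalgebra a) :
    CuntzBelow (hS.emb t) (hS.emb a) := by
  let _ := CStarAlgebra.spectralOrder hS.stab
  have _ := CStarAlgebra.spectralOrderedRing hS.stab
  have := isClosed_hereditarySubalgebra a
  obtain ⟨q, hq, hqq⟩ := exists_mul_self_eq_of_nonneg (t := (⟨t, hta⟩ : hereditarySubalgebra a)) ht
  have hqt : (q : A) * star (q : A) = t := by
    have h1 := congrArg Subtype.val hqq
    have h2 : star (q : A) = q := congrArg Subtype.val hq.star_eq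
    rw [h2]
    exact h1
  rw [← hqt, map_mul, map_star]
  refine cuntzBelow_mul_star_of_mem_closure (map_nonneg hS.emb ha) ?_
  refine map_mem_closure (continuous_nonUnitalStarAlgHom hS.emb) q.2.1 ?_
  rintro _ ⟨r, rfl⟩
  exact ⟨hS.emb r, (map_mul hS.emb r a).symm⟩

variable {A : Type} [NonUnitalCStarAlgebra A] {S : Type*} [CuSemigroup S]

theorem isSumOfHalves_of_wayBelow (hS : IsCuntzSemigroupOf A S) (hA : NowhereScattered A) {a : A}
    (ha : CStarNonneg a) {x : S} (hx : WayBelow x (hS.clsA a)) :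
    IsSumOfHalves (hS.clsA a) x := by
  let _ := CStarAlgebra.spectralOrder hS.stab
  have _ := CStarAlgebra.spectralOrderedRing hS.stab
  let _ := CStarAlgebra.spectralOrder A
  have _ := CStarAlgebra.spectralOrderedRing A
  rw [cStarNonneg_iff_nonneg] at ha
  have hιa : 0 ≤ hS.emb a := map_nonneg hS.emb ha
  have hcl := isClosed_hereditarySubalgebra a
  have hιc : Continuous hS.emb := continuous_nonUnitalStarAlgHom _
  rw [clsA_eq_cls_emb] at hx ⊢
  obtain ⟨ε, hε, hx⟩ := (hS.wayBelow_cls_iff hιa).1 hx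
  refine IsSumOfHalves.mono ?_ hx
  let Dom : hereditarySubalgebra a → Prop := fun x => ∃ w : hS.stab, 0 ≤ w ∧
    IsSumOfHalves (hS.cls (hS.emb a)) (hS.cls w) ∧ hS.emb x + star (hS.emb x) ≤ w
  have hDadd : ∀ {v w : hS.stab}, 0 ≤ v → 0 ≤ w →
      IsSumOfHalves (hS.cls (hS.emb a)) (hS.cls v) →
      IsSumOfHalves (hS.cls (hS.emb a)) (hS.cls w) →
      IsSumOfHalves (hS.cls (hS.emb a)) (hS.cls (v + w)) := fun hv hw h1 h2 =>
    (h1.add h2).mono (hS.cls_add_le hv hw)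
  have hsa : IsSelfAdjoint (⟨a, self_mem_hereditarySubalgebra ha⟩ : hereditarySubalgebra a) :=
    Subtype.ext (IsSelfAdjoint.of_nonneg ha).star_eq
  refine (dom_cutDown_or_exists_character hsa hε Dom ?_ ?_ ?_).elim (fun h => ?_)
    fun ⟨χ, b, hb⟩ => ?_
  · exact ⟨0, le_rfl, by rw [hS.cls_zero]; exact .zero _, by simp⟩
  · rintro x y ⟨v, hv, hDv, hxv⟩ ⟨w, hw, hDw, hyw⟩
    refine ⟨v + w, add_nonneg hv hw, hDadd hv hw hDv hDw, ?_⟩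
    rw [NonUnitalStarSubalgebra.coe_add, map_add, star_add, add_add_add_comm]
    exact add_le_add hxv hyw
  · intro y hy k l
    set X := hS.emb y with hX
    set K := hS.emb k with hK
    set L := hS.emb l with hL
    have hz : 0 ≤ star X * X := star_mul_self_nonneg X
    have hXX : X * X = 0 := by
      rw [hX, ← map_mul, ← NonUnitalStarSubalgebra.coe_mul, hy, NonUnitalStarSubalgebra.coe_zero,
        map_zero]
    have horth : star X * X * (X * star X) = 0 := by
      rw [mul_assoc, ← mul_assoc X, hXX, zero_mul, mul_zero]
    have htwo : 2 • hS.cls (star X * X) ≤ hS.cls (hS.emb a) := by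
      have h1 : hS.cls (star X * X) ≤ hS.cls (X * star X) := by
        refine hS.cls_le_cls hz (mul_star_self_nonneg X) ?_
        simpa using cuntzBelow_mul_star_of_star_mul_self_le (y := star X) le_rfl
      have h2 : hS.cls (star X * X + X * star X) = hS.cls (star X * X) + hS.cls (X * star X) :=
        hS.cls_add_orth _ _ (cStarNonneg_iff_nonneg.2 hz)
          (cStarNonneg_iff_nonneg.2 (mul_star_self_nonneg X)) horth
      rw [two_nsmul]
      refine (add_le_add_right h1 _).trans ?_
      rw [← h2]
      refine hS.cls_le_cls (add_nonneg hz (mul_star_self_nonneg X)) hιa ?_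
      have h3 := hS.emb_cuntzBelow_of_mem_hereditarySubalgebra ha
        (t := (star y * y + y * star y : hereditarySubalgebra a))
        (add_nonneg (star_mul_self_nonneg (y : A)) (mul_star_self_nonneg (y : A)))
        (Subtype.coe_prop _)
      simpa [map_add, map_mul, map_star, hX] using h3
    have hhalf := IsSumOfHalves.of_two_nsmul_le htwo
    have hk : 0 ≤ K * (star X * X) * star K := star_right_conjugate_nonneg hz K
    have hl : 0 ≤ star L * (star X * X) * star (star L) := star_right_conjugate_nonneg hz (star L)
    refine ⟨K * (star X * X) * star K + star L * (star X * X) * star (star L), add_nonneg hk hl,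
      hDadd hk hl (hhalf.mono (hS.cls_conjugate_le hz K))
        (hhalf.mono (hS.cls_conjugate_le hz (star L))), ?_⟩
    have hpos := star_right_conjugate_nonneg hz (K - star L)
    rw [← sub_nonneg]
    convert hpos using 1
    simp only [NonUnitalStarSubalgebra.coe_mul, StarMemClass.coe_star, map_mul, map_star, ← hX,
      ← hK, ← hL, star_mul, star_star, star_sub, mul_sub, sub_mul, mul_assoc]
    abel
  · obtain ⟨w, hw, hD, hle⟩ := h
    refine hD.mono (hS.cls_mono (cfcₙ_cutDown_nonneg _ _) ?_)
    have hmap : hS.emb (cfcₙ (fun t : ℝ => max (t - ε) 0)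
        (⟨a, self_mem_hereditarySubalgebra ha⟩ : hereditarySubalgebra a) : hereditarySubalgebra a) =
        cfcₙ (fun t : ℝ => max (t - ε) 0) (hS.emb a) :=
      NonUnitalStarAlgHom.map_cfcₙ
        (hS.emb.comp (NonUnitalStarSubalgebraClass.subtype (hereditarySubalgebra a)))
        (fun t : ℝ => max (t - ε) 0) _ (by fun_prop) (by simp [hε.le])
        (hιc.comp continuous_subtype_val) hsa hιa.isSelfAdjoint
    have h0 := cfcₙ_cutDown_nonneg (hS.emb a) ε
    rw [hmap, h0.isSelfAdjoint.star_eq] at hle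
    exact (le_add_of_nonneg_right h0).trans hle
  · exact absurd (hasNonzeroElementaryIdealQuotient_of_character
      (fun b hb c hc x => mul_mul_mem_hereditarySubalgebra hb hc x) χ hb) hA

theorem isSumOfHalves_of_wayBelow_nsmul (hS : IsCuntzSemigroupOf A S) (hA : NowhereScattered A)
    {a : A} (ha : CStarNonneg a) (n : ℕ) {x : S} (hx : WayBelow x (n • hS.clsA a)) :
    IsSumOfHalves (hS.clsA a) x := by
  induction n generalizing x with
  | zero =>
    refine (IsSumOfHalves.zero _).mono ?_
    obtain ⟨n, hn⟩ := hx (fun _ => 0) monotone_const 0 (by simp) (by simp)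
    exact hn
  | succ n ih =>
    rw [succ_nsmul] at hx
    obtain ⟨y, z, hy, hz, hxyz⟩ := hS.exists_wayBelow_of_wayBelow_add hx
    exact ((ih hy).add (hS.isSumOfHalves_of_wayBelow hA ha hz)).mono hxyz

theorem isWeaklyOmegaDivisible_nsmul (hS : IsCuntzSemigroupOf A S) (hA : NowhereScattered A)
    {a : A} (ha : CStarNonneg a) (n : ℕ) :
    CuDiv.IsWeaklyOmegaDivisible (2 * n) (n • hS.clsA a) := by
  intro x hx
  obtain ⟨L, hL, hxL⟩ := hS.isSumOfHalves_of_wayBelow_nsmul hA ha n hx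
  refine ⟨L.length, L.get, ?_, fun j => ?_⟩
  · rwa [← List.sum_ofFn, List.ofFn_get]
  · rw [mul_comm, mul_nsmul']
    exact nsmul_le_nsmul_right (hL _ (L.get_mem j)) n

end IsCuntzSemigroupOf

section Gram

variable {B : Type*} [NonUnitalCStarAlgebra B] [PartialOrder B] [StarOrderedRing B]

/-- The matrices `(rᵢ w rⱼ*)`. -/
def gramSet {B : Type*} [NonUnitalCStarAlgebra B] (m : ℕ) (w : B) : Set (Fin m → Fin m → B) :=
  Set.range fun (r : Fin m → B) i j => r i * w * star (r j)

theorem gram_mem_closure_gramSet {m : ℕ} {w : B} (hw : 0 ≤ w) {T : Fin m → B}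
    (hT : ∀ i, T i ∈ closure (Set.range fun r : B => r * w)) :
    (fun i j => T i * star (T j)) ∈ closure (gramSet m w) := by
  obtain ⟨h, hh, rfl⟩ := exists_isSelfAdjoint_mul_self_eq hw
  have hT' : T ∈ closure (Set.univ.pi fun _ : Fin m => Set.range fun r : B => r * (h * h)) := by
    rw [closure_pi_set]
    exact fun i _ => hT i
  refine map_mem_closure (f := fun (T : Fin m → B) i j => T i * star (T j)) (by fun_prop) hT' ?_
  intro T hT
  choose x hx using fun i => hT i (Set.mem_univ i)
  refine ⟨fun i => x i * h, ?_⟩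
  funext i j
  simp [← hx, hh.star_eq, mul_assoc]

theorem closure_gramSet_subset_of_cuntzBelow {B : Type*} [NonUnitalCStarAlgebra B] {m : ℕ}
    {c c' : B} (h : CuntzBelow c c') : closure (gramSet m c) ⊆ closure (gramSet m c') := by
  refine closure_minimal ?_ isClosed_closure
  rintro _ ⟨u, rfl⟩
  refine map_mem_closure (f := fun (c : B) (i j : Fin m) => u i * c * star (u j)) (by fun_prop)
    (cuntzBelow_iff_mem_closure.1 h) ?_
  rintro _ ⟨r, rfl⟩
  refine ⟨fun i => u i * r, ?_⟩
  funext i j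
  simp [mul_assoc]

/-- The block sum of a scalar block and a matrix. -/
def blockCons {B : Type*} [Zero B] {m : ℕ} (β : B) (M : Fin m → Fin m → B) :
    Fin (m + 1) → Fin (m + 1) → B :=
  Fin.cons (Fin.cons β fun _ => 0) fun i => Fin.cons 0 fun j => M i j

theorem continuous_blockCons {B : Type*} [Zero B] [TopologicalSpace B] {m : ℕ} :
    Continuous fun q : B × (Fin m → Fin m → B) => blockCons q.1 q.2 := by
  refine continuous_pi fun i => continuous_pi fun j => ?_
  cases i using Fin.cases <;> cases j using Fin.cases <;> simp only [blockCons, Fin.cons_zero,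
    Fin.cons_succ] <;> fun_prop

theorem blockCons_mem_closure_gramSet {m : ℕ} {c₁ c₂ β : B} {M : Fin m → Fin m → B}
    (h₁ : 0 ≤ c₁) (h₂ : 0 ≤ c₂) (h : c₁ * c₂ = 0) (hβ : CuntzBelow β c₂)
    (hM : M ∈ closure (gramSet m c₁)) :
    blockCons β M ∈ closure (gramSet (m + 1) (c₁ + c₂)) := by
  obtain ⟨x, hx, rfl⟩ := exists_isSelfAdjoint_mul_self_eq h₁
  obtain ⟨y, hy, rfl⟩ := exists_isSelfAdjoint_mul_self_eq h₂
  have hxy := mul_eq_zero_of_mul_self_mul_mul_self_eq_zero hx hy h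
  have hyx : y * x = 0 := by simpa [hx.star_eq, hy.star_eq] using congrArg star hxy
  rw [← closure_closure]
  have hβM : (β, M) ∈ closure ((Set.range fun r : B => r * (y * y) * star r) ×ˢ
      gramSet m (x * x)) := by
    rw [closure_prod_eq]
    exact ⟨cuntzBelow_iff_mem_closure.1 hβ, hM⟩
  refine map_mem_closure (f := fun q : B × (Fin m → Fin m → B) => blockCons q.1 q.2)
    continuous_blockCons hβM ?_
  rintro ⟨_, _⟩ ⟨⟨v, rfl⟩, ⟨u, rfl⟩⟩
  have hX : x ∈ closure (Set.range fun t : B => t * (x * x + y * y)) :=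
    mem_closure_range_mul_right_of_star_mul_self_le
      (by rw [hx.star_eq]; exact le_add_of_nonneg_right h₂)
  have hY : y ∈ closure (Set.range fun t : B => t * (x * x + y * y)) :=
    mem_closure_range_mul_right_of_star_mul_self_le
      (by rw [hy.star_eq]; exact le_add_of_nonneg_left h₁)
  have key := gram_mem_closure_gramSet (add_nonneg h₁ h₂)
    (T := (Fin.cons (v * y) fun i => u i * x : Fin (m + 1) → B)) fun i => by
      cases i using Fin.cases with
      | zero => exact mul_mem_closure_range_mul_right v hY
      | succ i => exact mul_mem_closure_range_mul_right (u i) hX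
  convert key using 1
  funext i j
  have e1 : ∀ r s : B, r * x * (y * s) = 0 := fun r s => by
    rw [mul_assoc, ← mul_assoc x, hxy, zero_mul, mul_zero]
  have e2 : ∀ r s : B, r * y * (x * s) = 0 := fun r s => by
    rw [mul_assoc, ← mul_assoc y, hyx, zero_mul, mul_zero]
  cases i using Fin.cases <;> cases j using Fin.cases <;>
    simp [blockCons, hx.star_eq, hy.star_eq, e1, e2]
  all_goals simp [mul_assoc]

/-- The sums of `n` conjugates of `F`. -/
def conjugateSums {B : Type*} [NonUnitalCStarAlgebra B] (n : ℕ) (F : B) : Set B :=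
  Set.range fun v : Fin n → B => ∑ k, v k * F * star (v k)

end Gram

namespace IsCuntzSemigroupOf

variable {A : Type*} [NonUnitalCStarAlgebra A] {S : Type*} [CuSemigroup S]
  (hS : IsCuntzSemigroupOf A S) [PartialOrder hS.stab] [StarOrderedRing hS.stab]

theorem mem_closure_conjugateSums {F : hS.stab} (hF : 0 ≤ F) (n : ℕ) {d : hS.stab} (hd : 0 ≤ d)
    (h : hS.cls d ≤ n • hS.cls F) : d ∈ closure (conjugateSums n F) := by
  induction n generalizing d with
  | zero =>
    rw [zero_nsmul, ← hS.cls_zero] at h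
    obtain ⟨r, hr⟩ := hS.cuntzBelow_of_cls_le hd le_rfl h
    simp only [mul_zero, zero_mul] at hr
    rw [tendsto_nhds_unique hr tendsto_const_nhds]
    exact subset_closure ⟨0, by simp⟩
  | succ n ih =>
    obtain ⟨d₁, d₂, h₁, h₂, -, hd₁, hd₂, hsum⟩ :=
      hS.exists_nonneg_orthogonal (n • hS.cls F) (hS.cls F)
    rw [succ_nsmul, ← hsum] at h
    have hdc := cuntzBelow_iff_mem_closure.1
      (hS.cuntzBelow_of_cls_le hd (add_nonneg h₁ h₂) h)
    refine closure_minimal ?_ isClosed_closure hdc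
    rintro _ ⟨r, rfl⟩
    have hd₂F := cuntzBelow_iff_mem_closure.1 (hS.cuntzBelow_of_cls_le h₂ hF hd₂.le)
    refine map_mem_closure₂ (f := fun x y => r * (x + y) * star r) (by fun_prop)
      (ih h₁ hd₁.le) hd₂F ?_
    rintro _ ⟨v, rfl⟩ _ ⟨s, rfl⟩
    refine ⟨Fin.snoc (fun k => r * v k) (r * s), ?_⟩
    simp [Fin.sum_univ_castSucc, mul_add, add_mul, Finset.mul_sum, Finset.sum_mul, mul_assoc]

theorem diagonal_mem_closure_gramSet {b : hS.stab} (hb : 0 ≤ b) (m : ℕ) {c : hS.stab} (hc : 0 ≤ c)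
    (h : m • hS.cls b ≤ hS.cls c) :
    (fun i j => if i = j then b else 0) ∈ closure (gramSet m c) := by
  induction m generalizing c with
  | zero => exact subset_closure ⟨0, by funext i; exact i.elim0⟩
  | succ m ih =>
    obtain ⟨c₁, c₂, h₁, h₂, horth, hc₁, hc₂, hsum⟩ :=
      hS.exists_nonneg_orthogonal (m • hS.cls b) (hS.cls b)
    rw [succ_nsmul, ← hsum] at h
    refine closure_gramSet_subset_of_cuntzBelow
      (hS.cuntzBelow_of_cls_le (add_nonneg h₁ h₂) hc h) ?_
    convert blockCons_mem_closure_gramSet h₁ h₂ horth (hS.cuntzBelow_of_cls_le hb h₂ hc₂.ge)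
      (ih h₁ hc₁.ge) using 1
    funext i j
    cases i using Fin.cases <;> cases j using Fin.cases <;> simp [blockCons, Fin.succ_ne_zero]
    exact fun h => absurd h.symm (Fin.succ_ne_zero _)

end IsCuntzSemigroupOf

theorem matPad_single {A : Type*} [Zero A] (n : ℕ) (x : A) :
    matPad (Matrix.single (0 : Fin (n + 1)) 0 x) = Matrix.single (0 : Fin (n + 2)) 0 x := by
  ext i j
  rw [matPad, Matrix.of_apply, Matrix.single_apply]
  split_ifs with h h₀ h₀
  · obtain ⟨rfl, rfl⟩ := h₀
    exact Matrix.single_apply_same ..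
  · rw [Matrix.single_apply, if_neg]
    rintro ⟨hi, hj⟩
    rw [Fin.ext_iff] at hi hj
    exact h₀ ⟨Fin.ext hi, Fin.ext hj⟩
  · obtain ⟨rfl, rfl⟩ := h₀
    exact absurd ⟨n.succ_pos, n.succ_pos⟩ h
  · rfl

namespace IsCuntzSemigroupOf

variable {A : Type*} [NonUnitalCStarAlgebra A] {S : Type*} [CuSemigroup S]
  (hS : IsCuntzSemigroupOf A S)

theorem matEmb_single (n : ℕ) (x : A) : hS.matEmb (n + 1) (Matrix.single 0 0 x) = hS.emb x := by
  induction n with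
  | zero =>
    change _ = hS.matEmb 1 (matOne A x)
    congr 1
    ext i j
    obtain rfl : i = 0 := Fin.ext (by omega)
    obtain rfl : j = 0 := Fin.ext (by omega)
    exact Matrix.single_apply_same ..
  | succ n ih => rw [← matPad_single, hS.matEmb_compat (n + 1), ih]

theorem exists_emb_eq_mul_mul (J : ClosedTwoSidedIdealC A) {x : A} (hx : x ∈ J.carrier) (y : A)
    (X : hS.stab) : ∃ j : J.carrier, hS.emb j = hS.emb x * X * hS.emb y := by
  have : IsClosed (J.carrier : Set A) := J.isClosed
  have hcl := isClosed_range_nonUnitalStarAlgHom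
    (hS.emb.comp (NonUnitalStarSubalgebraClass.subtype J.carrier))
  have hX : X ∈ closure (⋃ n, Set.range (hS.matEmb n)) := hS.matEmb_dense X
  change hS.emb x * X * hS.emb y ∈
    Set.range (hS.emb.comp (NonUnitalStarSubalgebraClass.subtype J.carrier))
  rw [← hcl.closure_eq]
  refine map_mem_closure (f := fun X => hS.emb x * X * hS.emb y) (by fun_prop) hX ?_
  intro Y hY
  obtain ⟨n, M, rfl⟩ := Set.mem_iUnion.1 hY
  cases n with
  | zero =>
    refine ⟨0, ?_⟩
    rw [Subsingleton.elim M 0]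
    simp
  | succ n =>
    refine ⟨⟨x * M 0 0 * y, J.mul_mem_right _ _ (J.mul_mem_right _ _ hx)⟩, ?_⟩
    change hS.emb (x * M 0 0 * y) = hS.emb x * hS.matEmb (n + 1) M * hS.emb y
    rw [← hS.matEmb_single n, ← hS.matEmb_single n, ← hS.matEmb_single n, ← map_mul, ← map_mul,
      Matrix.single_mul_mul_single]

/-- An elementary ideal-quotient provides a functional on the stabilization that is multiplicative
relative to the class of a lift of a minimal projection. -/
theorem exists_functional (hA : HasNonzeroElementaryIdealQuotient A) :
    ∃ (a : A) (Φ : hS.stab →L[ℂ] ℂ), CStarNonneg a ∧ Φ (hS.emb a) ≠ 0 ∧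
      (∀ X, Φ (star X) = star (Φ X)) ∧ ∀ X Y, Φ (X * hS.emb a * Y) = Φ X * Φ Y := by
  obtain ⟨J, H, _, _, _, ψ, hψ, x₀, hx₀⟩ := hA
  have : IsClosed (J.carrier : Set A) := J.isClosed
  obtain ⟨ξ, hξ⟩ : ∃ ξ : H, ‖ξ‖ = 1 := by
    have : Nontrivial H := by
      by_contra hH
      rw [not_nontrivial_iff_subsingleton] at hH
      exact hx₀ (Subsingleton.elim _ _)
    exact exists_norm_eq H zero_le_one
  obtain ⟨x, hx⟩ : InnerProductSpace.rankOne ℂ ξ ξ ∈ Set.range ψ := by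
    rw [hψ]
    exact isCompactOperator_rankOne ξ ξ
  set p : H →L[ℂ] H := InnerProductSpace.rankOne ℂ ξ ξ with hp
  have hpξ : ∀ η, p η = inner ℂ ξ η • ξ := fun η => by
    rw [hp, InnerProductSpace.rankOne_apply]
  have hpp : p * p = p := by
    ext η
    simp [hpξ, inner_self_eq_norm_sq_to_K, hξ]
  have hps : star p = p := by
    rw [hp, ContinuousLinearMap.star_eq_adjoint, InnerProductSpace.adjoint_rankOne]
  set e : J.carrier := star x * x with he
  have hes : star (e : A) = e := congrArg Subtype.val (IsSelfAdjoint.star_mul_self x).star_eq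
  have hψe : ψ e = p := by rw [he, map_mul, map_star, hx, hps, hpp]
  clear_value e
  choose j hj using fun X => hS.exists_emb_eq_mul_mul J e.2 e X
  have hinj : ∀ {u v : J.carrier}, hS.emb u = hS.emb v → u = v := fun h =>
    Subtype.ext (hS.emb_injective h)
  have hadd : ∀ X Y, j (X + Y) = j X + j Y := fun X Y => hinj (by
    rw [NonUnitalStarSubalgebra.coe_add, map_add, hj, hj, hj, mul_add, add_mul])
  have hsmul : ∀ (c : ℂ) X, j (c • X) = c • j X := fun c X => hinj (by
    rw [NonUnitalStarSubalgebra.coe_smul, map_smul, hj, hj, mul_smul_comm, smul_mul_assoc])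
  have hstar : ∀ X, j (star X) = star (j X) := fun X => hinj (by
    rw [StarMemClass.coe_star, map_star, hj, hj, star_mul, star_mul, ← map_star, hes, mul_assoc])
  have hmul : ∀ X Y, j (X * hS.emb (e * e * e * e) * Y) = j X * (e * e) * j Y := fun X Y => hinj (by
    simp only [NonUnitalStarSubalgebra.coe_mul, map_mul, hj, mul_assoc])
  have hemb : ∀ y : J.carrier, j (hS.emb y) = e * y * e := fun y => hinj (by
    simp only [NonUnitalStarSubalgebra.coe_mul, map_mul, hj])
  let Φ : hS.stab →L[ℂ] ℂ := LinearMap.mkContinuous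
    { toFun := fun X => inner ℂ ξ (ψ (j X) ξ)
      map_add' := fun X Y => by rw [hadd, map_add, add_apply, inner_add_right]
      map_smul' := fun c X => by
        rw [hsmul, map_smul, smul_apply, inner_smul_right]; rfl }
    (‖hS.emb e‖ * ‖hS.emb e‖) fun X => by
      change ‖inner ℂ ξ (ψ (j X) ξ)‖ ≤ _
      calc ‖inner ℂ ξ (ψ (j X) ξ)‖ ≤ ‖ξ‖ * ‖ψ (j X) ξ‖ := norm_inner_le_norm _ _
        _ ≤ ‖ψ (j X)‖ := by simpa [hξ] using (ψ (j X)).le_opNorm ξ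
        _ ≤ ‖j X‖ := NonUnitalStarAlgHom.norm_apply_le ψ _
        _ = ‖hS.emb (j X)‖ := (NonUnitalStarAlgHom.norm_map hS.emb hS.emb_injective _).symm
        _ = ‖hS.emb e * X * hS.emb e‖ := by rw [hj]
        _ ≤ ‖hS.emb e‖ * ‖X‖ * ‖hS.emb e‖ := norm_mul₃_le
        _ = ‖hS.emb e‖ * ‖hS.emb e‖ * ‖X‖ := by ring
  have hΦ : ∀ X, Φ X = inner ℂ ξ (ψ (j X) ξ) := fun X => rfl
  refine ⟨e * e * e * e, Φ, ⟨e * e, by simp [hes, mul_assoc]⟩, ?_, fun X => ?_, fun X Y => ?_⟩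
  · have h1 : ψ (j (hS.emb (e * e * e * e))) = p := by
      rw [show (e * e * e * e : A) = ((e * e * e * e : J.carrier) : A) from rfl, hemb]
      simp only [map_mul, hψe, hpp]
    rw [hΦ, h1, hpξ, inner_smul_right]
    simp [inner_self_eq_norm_sq_to_K, hξ]
  · rw [hΦ, hΦ, hstar, map_star, ContinuousLinearMap.star_eq_adjoint,
      ContinuousLinearMap.adjoint_inner_right]
    exact (inner_conj_symm _ _).symm
  · rw [hΦ, hΦ, hΦ, hmul]
    simp only [map_mul, hψe, hpp]
    simp [hpξ, mul_comm]

end IsCuntzSemigroupOf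

theorem Matrix.det_mul_eq_zero_of_card_lt {K m n : Type*} [Field K] [Fintype m] [DecidableEq m]
    [Fintype n] (h : Fintype.card n < Fintype.card m) (P : Matrix m n K) (Q : Matrix n m K) :
    (P * Q).det = 0 := by
  by_contra hdet
  have hrank := Matrix.rank_of_isUnit (P * Q)
    ((Matrix.isUnit_iff_isUnit_det _).2 (isUnit_iff_ne_zero.2 hdet))
  have := (Matrix.rank_mul_le_left P Q).trans (Matrix.rank_le_card_width P)
  omega

theorem functional_conjugate_eq_zero_of_cuntzBelow {B : Type*} [NonUnitalCStarAlgebra B]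
    {Φ : B →L[ℂ] ℂ} {b d : B} (hd : ∀ s, Φ (s * d * star s) = 0) (h : CuntzBelow b d) (s : B) :
    Φ (s * b * star s) = 0 := by
  obtain ⟨r, hr⟩ := h
  have hlim : Tendsto (fun n => Φ (s * (r n * d * star (r n)) * star s)) atTop
      (𝓝 (Φ (s * b * star s))) :=
    ((by fun_prop : Continuous fun X => Φ (s * X * star s)).tendsto b).comp hr
  refine tendsto_nhds_unique hlim ?_
  refine tendsto_const_nhds.congr fun n => ?_
  rw [← hd (s * r n), star_mul]
  simp only [mul_assoc]

namespace IsCuntzSemigroupOf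

variable {A : Type*} [NonUnitalCStarAlgebra A] {S : Type*} [CuSemigroup S]
  (hS : IsCuntzSemigroupOf A S) [PartialOrder hS.stab] [StarOrderedRing hS.stab]

theorem functional_conjugate_eq_zero {F : hS.stab} (hF : 0 ≤ F) {Φ : hS.stab →L[ℂ] ℂ}
    (hstar : ∀ X, Φ (star X) = star (Φ X)) (hmul : ∀ X Y, Φ (X * F * Y) = Φ X * Φ Y) {n : ℕ}
    {b : hS.stab} (hb : 0 ≤ b) (h : (n + 1) • hS.cls b ≤ n • hS.cls F) (s : hS.stab) :
    Φ (s * b * star s) = 0 := by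
  obtain ⟨c, hc, hcF⟩ := hS.cls_surj (n • hS.cls F)
  rw [cStarNonneg_iff_nonneg] at hc
  let D : (Fin (n + 1) → Fin (n + 1) → hS.stab) → ℂ := fun M =>
    Matrix.det (Matrix.of fun i j => Φ (s * M i j * star s))
  have hD : Continuous D := by
    refine Continuous.matrix_det ?_
    refine continuous_matrix fun i j => ?_
    simp only [Matrix.of_apply]
    fun_prop
  have hconj : ∀ (r : Fin (n + 1) → hS.stab), ∀ d ∈ conjugateSums n F,
      D (fun i j => r i * d * star (r j)) = 0 := by
    rintro r _ ⟨v, rfl⟩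
    have hG : (Matrix.of fun i j => Φ (s * (r i * (∑ k, v k * F * star (v k)) * star (r j)) *
        star s)) = (Matrix.of fun i k => Φ (s * r i * v k)) *
          Matrix.of fun k j => star (Φ (s * r j * v k)) := by
      ext i j
      rw [Matrix.mul_apply]
      simp only [Matrix.of_apply, Finset.mul_sum, Finset.sum_mul, map_sum, ← hstar, ← hmul]
      simp only [star_mul, mul_assoc]
    exact (congrArg Matrix.det hG).trans (Matrix.det_mul_eq_zero_of_card_lt (by simp) _ _)
  have hgram : ∀ M ∈ gramSet (n + 1) c, D M = 0 := by
    rintro _ ⟨r, rfl⟩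
    have hcl : c ∈ closure (conjugateSums n F) :=
      hS.mem_closure_conjugateSums hF n hc hcF.le
    have := map_mem_closure (t := {0}) (f := fun d => D fun i j => r i * d * star (r j))
      (by fun_prop) hcl fun d hd => hconj r d hd
    simpa using this
  have hb0 := map_mem_closure (t := {0}) hD
    (hS.diagonal_mem_closure_gramSet hb (n + 1) hc (h.trans hcF.ge)) fun M hM => hgram M hM
  have hdiag : (Matrix.of fun i j : Fin (n + 1) => Φ (s * (if i = j then b else 0) * star s)) =
      Matrix.diagonal fun _ => Φ (s * b * star s) := by
    ext i j
    by_cases hij : i = j <;> simp [hij]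
  rw [closure_singleton, Set.mem_singleton_iff] at hb0
  have hdet := (congrArg Matrix.det hdiag).symm.trans hb0
  rw [Matrix.det_diagonal, Finset.prod_const] at hdet
  exact eq_zero_of_pow_eq_zero hdet

/-- The elements of the Cuntz semigroup all of whose representatives, conjugated arbitrarily, lie
in the kernel of `Φ`. -/
def IsNullClass (Φ : hS.stab →L[ℂ] ℂ) (y : S) : Prop :=
  ∀ b : hS.stab, 0 ≤ b → hS.cls b ≤ y → ∀ s, Φ (s * b * star s) = 0

theorem isNullClass_add {Φ : hS.stab →L[ℂ] ℂ} {y z : S} (hy : hS.IsNullClass Φ y)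
    (hz : hS.IsNullClass Φ z) : hS.IsNullClass Φ (y + z) := by
  intro b hb hbyz
  obtain ⟨c, d, hc, hd, -, hcy, hdz, hcd⟩ := hS.exists_nonneg_orthogonal y z
  refine functional_conjugate_eq_zero_of_cuntzBelow (d := c + d) (fun s => ?_)
    (hS.cuntzBelow_of_cls_le hb (add_nonneg hc hd) (hbyz.trans hcd.ge))
  rw [mul_add, add_mul, map_add, hy c hc hcy.le, hz d hd hdz.le, add_zero]

theorem isNullClass_zero (Φ : hS.stab →L[ℂ] ℂ) : hS.IsNullClass Φ 0 := by
  intro b hb hb0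
  refine functional_conjugate_eq_zero_of_cuntzBelow (d := 0) (fun s => by simp)
    (hS.cuntzBelow_of_cls_le hb le_rfl (hb0.trans hS.cls_zero.ge))

theorem isNullClass_sum (Φ : hS.stab →L[ℂ] ℂ) {m : ℕ} (y : Fin m → S)
    (hy : ∀ j, hS.IsNullClass Φ (y j)) : hS.IsNullClass Φ (∑ j, y j) :=
  Finset.sum_induction _ _ (fun _ _ => hS.isNullClass_add) (hS.isNullClass_zero Φ) fun j _ => hy j

/-- A functional that is multiplicative relative to `F` obstructs the weak divisibility of the
multiples of the class of `F`. -/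
theorem functional_eq_zero_of_isWeaklyOmegaDivisible {F : hS.stab} (hF : 0 ≤ F)
    {Φ : hS.stab →L[ℂ] ℂ} (hstar : ∀ X, Φ (star X) = star (Φ X))
    (hmul : ∀ X Y, Φ (X * F * Y) = Φ X * Φ Y) {n : ℕ} (hn : 1 ≤ n)
    (h : CuDiv.IsWeaklyOmegaDivisible (n + 1) (n • hS.cls F)) : Φ F = 0 := by
  have hle : hS.cls F ≤ n • hS.cls F := by
    simpa using nsmul_le_nsmul_left (CuSemigroup.zero_le' (hS.cls F)) hn
  have hcut : ∀ ε : ℝ, 0 < ε →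
      Φ (F * cfcₙ (fun t : ℝ => max (t - ε) 0) F * star F) = 0 := by
    intro ε hε
    have hwb : WayBelow (hS.cls (cfcₙ (fun t : ℝ => max (t - ε) 0) F)) (hS.cls F) :=
      (hS.wayBelow_cls_iff hF).2 ⟨ε, hε, le_rfl⟩
    obtain ⟨m, y, hy, hyF⟩ := h _ fun f hf t ht hFt => hwb f hf t ht (hle.trans hFt)
    refine hS.isNullClass_sum Φ y (fun j b hb hbj => ?_) _ (cfcₙ_cutDown_nonneg F ε) hy F
    exact hS.functional_conjugate_eq_zero hF hstar hmul hb
      ((nsmul_le_nsmul_right hbj _).trans (hyF j))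
  have hlim : Tendsto (fun ε : ℝ => cfcₙ (fun t : ℝ => max (t - ε) 0) F) (𝓝[>] 0) (𝓝 F) := by
    rw [tendsto_iff_norm_sub_tendsto_zero]
    refine squeeze_zero' (.of_forall fun _ => norm_nonneg _) ?_
      (tendsto_nhdsWithin_of_tendsto_nhds tendsto_id)
    filter_upwards [self_mem_nhdsWithin] with ε hε
    rw [norm_sub_rev]
    exact norm_sub_cfcₙ_cutDown_le hF (le_of_lt hε)
  have hFF : Φ (F * F * star F) = 0 := by
    refine tendsto_nhds_unique
      (((by fun_prop : Continuous fun X => Φ (F * X * star F)).tendsto F).comp hlim) ?_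
    refine tendsto_const_nhds.congr' ?_
    filter_upwards [self_mem_nhdsWithin] with ε hε
    exact (hcut ε hε).symm
  rw [hmul, hstar] at hFF
  simpa using hFF

end IsCuntzSemigroupOf

theorem nowhereScattered_of_isWeaklyOmegaDivisible {A : Type*} [NonUnitalCStarAlgebra A]
    {S : Type*} [CuSemigroup S] (hS : IsCuntzSemigroupOf A S)
    (h : ∀ a : A, CStarNonneg a → ∃ n : ℕ, 1 ≤ n ∧
      CuDiv.IsWeaklyOmegaDivisible (n + 1) (n • hS.clsA a)) : NowhereScattered A := by
  intro hA
  let _ : PartialOrder hS.stab := CStarAlgebra.spectralOrder hS.stab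
  have _ : StarOrderedRing hS.stab := CStarAlgebra.spectralOrderedRing hS.stab
  obtain ⟨a, Φ, ha, hΦa, hstar, hmul⟩ := hS.exists_functional hA
  obtain ⟨n, hn, hdiv⟩ := h a ha
  have hF : 0 ≤ hS.emb a := by
    obtain ⟨b, rfl⟩ := ha
    rw [map_mul, map_star]
    exact star_mul_self_nonneg _
  exact hΦa (hS.functional_eq_zero_of_isWeaklyOmegaDivisible hF hstar hmul hn hdiv)

/-- Lemma 5.4.  A C*-algebra `A` is nowhere scattered if and only if
`[a ⊗ 1ₙ] = n·[a]` is weakly `(2n, ω)`-divisible for every positive `a ∈ A` and every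
`n ≥ 1`, if and only if for every positive `a ∈ A` there is some `n ≥ 1` such that
`n·[a]` is weakly `(n+1, ω)`-divisible. -/
theorem nowhereScattered_iff_multiple_divisibility
    (A : Type) [NonUnitalCStarAlgebra A] (S : Type) [CuSemigroup S]
    (hS : IsCuntzSemigroupOf A S) :
    (NowhereScattered A ↔
      ∀ a : A, CStarNonneg a → ∀ n : ℕ, 1 ≤ n →
        CuDiv.IsWeaklyOmegaDivisible (2 * n) (n • hS.clsA a)) ∧
    (NowhereScattered A ↔
      ∀ a : A, CStarNonneg a → ∃ n : ℕ, 1 ≤ n ∧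
        CuDiv.IsWeaklyOmegaDivisible (n + 1) (n • hS.clsA a)) := by
  have hdiv (hA : NowhereScattered A) (a : A) (ha : CStarNonneg a) (n : ℕ) (_ : 1 ≤ n) :
      CuDiv.IsWeaklyOmegaDivisible (2 * n) (n • hS.clsA a) :=
    hS.isWeaklyOmegaDivisible_nsmul hA ha n
  have hscat := nowhereScattered_of_isWeaklyOmegaDivisible hS
  exact ⟨⟨hdiv, fun h => hscat fun a ha => ⟨1, le_rfl, h a ha 1 le_rfl⟩⟩,
    ⟨fun hA a ha => ⟨1, le_rfl, hdiv hA a ha 1 le_rfl⟩, hscat⟩⟩
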